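/- arXiv:2409.17149 — 4 statements merged into one kernel-verified Lean document; each statement's English description precedes it below -/
import Mathlib

section
/- ∫₁^∞ log(log(x)) / (1 − x + x²) dx = (π / (3√3)) · log( 4π² Γ(5/6)³ / Γ(1/6)³ ). -/
open MeasureTheory Real
open Filter Topology

noncomputable def kap (c t : ℝ) : ℝ := 2 * c / (t ^ 2 + c ^ 2)

lemma kap_re (c t : ℝ) : kap c t = 2 * (1 / ((c : ℂ) + t * Complex.I)).re := by
  simp [kap, Complex.normSq_apply]
  ring

noncomputable def SS (N : ℕ) (t : ℝ) : ℝ :=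
  ∑ n ∈ Finset.range (N + 1), (kap (2 * π * (n + 1 / 6)) t - kap (2 * π * (n + 5 / 6)) t)
    + 2 / 3 * kap (2 * π * (N + 1)) t

lemma int_log_base : IntegrableOn (fun t : ℝ => Real.log t / (1 + t ^ 2)) (Set.Ioi 0) := by
  have hm : Measurable (fun t : ℝ => Real.log t / (1 + t ^ 2)) := by fun_prop
  rw [← Set.Ioc_union_Ioi_eq_Ioi (zero_le_one' ℝ)]
  apply IntegrableOn.union
  · have h : IntegrableOn Real.log (Set.Ioc 0 1) :=
      (intervalIntegrable_iff_integrableOn_Ioc_of_le zero_le_one).1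
        intervalIntegral.intervalIntegrable_log'
    refine Integrable.mono h hm.aestronglyMeasurable (ae_of_all _ fun t => ?_)
    rw [norm_div]
    apply div_le_self (norm_nonneg _)
    rw [Real.norm_eq_abs, abs_of_pos (by positivity)]
    nlinarith [sq_nonneg t]
  · have h : IntegrableOn (fun t : ℝ => 2 * t ^ (-(3 / 2) : ℝ)) (Set.Ioi 1) :=
      (integrableOn_Ioi_rpow_of_lt (by norm_num) one_pos).const_mul 2
    refine Integrable.mono' h hm.aestronglyMeasurable ?_
    refine (ae_restrict_iff' measurableSet_Ioi).2 (ae_of_all _ fun t ht => ?_)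
    have ht1 : (1 : ℝ) < t := ht
    have ht0 : 0 < t := by linarith
    have h1 := Real.log_le_rpow_div ht0.le (show (0 : ℝ) < 1 / 2 by norm_num)
    have h0 := Real.log_nonneg ht1.le
    rw [Real.norm_eq_abs, abs_of_nonneg (by positivity), div_le_iff₀ (by positivity)]
    have e : t ^ (-(3 / 2) : ℝ) * t ^ 2 = t ^ (1 / 2 : ℝ) := by
      rw [← Real.rpow_natCast t 2, ← Real.rpow_add ht0]; norm_num
    have : 0 ≤ t ^ (-(3 / 2) : ℝ) := by positivity
    nlinarith

lemma integral_log_base : ∫ t in Set.Ioi (0:ℝ), Real.log t / (1 + t ^ 2) = 0 := by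
  have h := integral_comp_rpow_Ioi (fun t : ℝ => Real.log t / (1 + t ^ 2)) (p := -1) (by norm_num)
  have h2 : ∫ x in Set.Ioi (0:ℝ), (|(-1:ℝ)| * x ^ ((-1:ℝ) - 1)) •
      (Real.log (x ^ (-1:ℝ)) / (1 + (x ^ (-1:ℝ)) ^ 2))
      = ∫ t in Set.Ioi (0:ℝ), -(Real.log t / (1 + t ^ 2)) := by
    refine setIntegral_congr_fun measurableSet_Ioi fun x hx => ?_
    have hx0 : (0:ℝ) < x := hx
    have e : x ^ ((-1:ℝ) - 1) = (x ^ 2)⁻¹ := by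
      rw [show (-1:ℝ) - 1 = -(2:ℕ) by norm_num, Real.rpow_neg hx0.le, Real.rpow_natCast]
    simp only [e, Real.rpow_neg_one, Real.log_inv, smul_eq_mul, abs_neg, abs_one]
    field_simp
    ring
  rw [h2, integral_neg] at h
  linarith

lemma kap_scale (c : ℝ) (hc : 0 < c) (u : ℝ) (hu : 0 < u) : Real.log (c * u) * kap c (c * u) =
    2 / c * (Real.log c * (1 + u ^ 2)⁻¹ + Real.log u / (1 + u ^ 2)) := by
  rw [Real.log_mul hc.ne' hu.ne', kap]
  field_simp
  ring

lemma int_kap_aux (c : ℝ) : IntegrableOn (fun u : ℝ =>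
    2 / c * (Real.log c * (1 + u ^ 2)⁻¹ + Real.log u / (1 + u ^ 2))) (Set.Ioi 0) :=
  ((integrable_inv_one_add_sq.integrableOn.const_mul _).add int_log_base).const_mul _

lemma int_kap (c : ℝ) (hc : 0 < c) : IntegrableOn (fun t => Real.log t * kap c t) (Set.Ioi 0) := by
  have := integrableOn_Ioi_comp_mul_left_iff (fun t => Real.log t * kap c t) 0 hc
  rw [mul_zero] at this
  refine this.1 ((int_kap_aux c).congr_fun (fun u hu => ?_) measurableSet_Ioi)
  exact (kap_scale c hc u hu).symm

lemma integral_kap (c : ℝ) (hc : 0 < c) :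
    ∫ t in Set.Ioi (0:ℝ), Real.log t * kap c t = π * Real.log c := by
  have h := integral_comp_mul_left_Ioi (fun t => Real.log t * kap c t) 0 hc
  rw [mul_zero, setIntegral_congr_fun measurableSet_Ioi (fun u hu => kap_scale c hc u hu),
    integral_const_mul, integral_add (integrable_inv_one_add_sq.integrableOn.const_mul _)
    int_log_base, integral_const_mul, integral_log_base, integral_Ioi_inv_one_add_sq] at h
  simp only [arctan_zero, smul_eq_mul] at h
  field_simp at h
  linarith

lemma integral_SS (N : ℕ) : ∫ t in Set.Ioi (0:ℝ), Real.log t * SS N t =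
    π * (∑ n ∈ Finset.range (N + 1), (Real.log (2 * π * (n + 1 / 6)) -
      Real.log (2 * π * (n + 5 / 6))) + 2 / 3 * Real.log (2 * π * (N + 1))) := by
  have e : ∀ t, Real.log t * SS N t = ∑ n ∈ Finset.range (N + 1),
      (Real.log t * kap (2 * π * (n + 1 / 6)) t - Real.log t * kap (2 * π * (n + 5 / 6)) t)
      + 2 / 3 * (Real.log t * kap (2 * π * (N + 1)) t) := by
    intro t
    simp only [SS, mul_add, Finset.mul_sum, mul_sub]
    ring_nf
  have i1 : ∀ n : ℕ, IntegrableOn (fun t => Real.log t * kap (2 * π * (n + 1 / 6)) t) (Set.Ioi 0) :=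
    fun n => int_kap _ (by positivity)
  have i2 : ∀ n : ℕ, IntegrableOn (fun t => Real.log t * kap (2 * π * (n + 5 / 6)) t) (Set.Ioi 0) :=
    fun n => int_kap _ (by positivity)
  have i3 : IntegrableOn (fun t => Real.log t * kap (2 * π * (N + 1)) t) (Set.Ioi 0) :=
    int_kap _ (by positivity)
  have i12 : ∀ n : ℕ, IntegrableOn (fun t => Real.log t * kap (2 * π * (n + 1 / 6)) t -
      Real.log t * kap (2 * π * (n + 5 / 6)) t) (Set.Ioi 0) := fun n => (i1 n).sub (i2 n)
  simp_rw [e]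
  rw [integral_add (integrable_finsetSum _ fun n _ => i12 n) (i3.const_mul _),
    integral_finsetSum _ (fun n _ => i12 n), integral_const_mul,
    integral_kap _ (by positivity), mul_add π, Finset.mul_sum]
  congr 1
  · refine Finset.sum_congr rfl fun n _ => ?_
    rw [integral_sub (i1 n) (i2 n), integral_kap _ (by positivity), integral_kap _ (by positivity)]
    ring
  · ring

lemma kap_bound (c t : ℝ) (hc : 1 ≤ c) : |kap c t| ≤ 2 * c / (1 + t ^ 2) := by
  rw [kap, abs_of_nonneg (by positivity)]
  apply div_le_div_of_nonneg_left (by positivity) (by positivity)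
  nlinarith

lemma frac_id (w θ : ℂ) (h0 : w ≠ 0) (h1 : w + 6 * θ ≠ 0) (h2 : w + θ ≠ 0) (h3 : w + 5 * θ ≠ 0) :
    -(20 * θ ^ 3) / (w * (w + 6 * θ) * (w + θ) * (w + 5 * θ)) =
      1 / (w + θ) - 1 / (w + 5 * θ) + 2 / 3 * (1 / (w + 6 * θ) - 1 / w) := by
  have h30 : (3 : ℂ) ≠ 0 := by norm_num
  have p1 := mul_ne_zero h2 h3
  have p2 := mul_ne_zero h30 (mul_ne_zero h1 h0)
  rw [div_sub_div _ _ h2 h3, div_sub_div _ _ h1 h0, div_mul_div_comm, div_add_div _ _ p1 p2,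
    div_eq_div_iff (mul_ne_zero (mul_ne_zero (mul_ne_zero h0 h1) h2) h3) (mul_ne_zero p1 p2)]
  ring

lemma D_bound (N : ℕ) (t : ℝ) : |SS (N + 1) t - SS N t| ≤ 100 / ((N + 1) ^ 2) / (1 + t ^ 2) := by
  set c : ℝ := 2 * π * (N + 1) with hc
  set w : ℂ := (c : ℂ) + t * Complex.I with hw
  have hpi := Real.pi_gt_three
  have hpi4 := Real.pi_lt_four
  have hcp : 0 < c := by positivity
  have hN : (N + 1 : ℝ) ≤ c := by rw [hc]; nlinarith [(Nat.cast_nonneg N : (0:ℝ) ≤ N)]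
  have hnw : ∀ a : ℝ, 0 ≤ a → c ^ 2 + t ^ 2 ≤ ‖w + a‖ ^ 2 := by
    intro a ha
    rw [← Complex.normSq_eq_norm_sq, Complex.normSq_apply]
    simp [hw]
    nlinarith
  have hpos : ∀ a : ℝ, 0 ≤ a → 0 < ‖w + a‖ := by
    intro a ha
    by_contra h
    have h0 : ‖w + a‖ = 0 := le_antisymm (not_lt.1 h) (norm_nonneg _)
    have := hnw a ha
    rw [h0] at this
    nlinarith [sq_nonneg t]
  have hk : ∀ a : ℝ, kap (c + a) t = 2 * (1 / (w + a)).re := by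
    intro a
    rw [kap_re, hw]; push_cast; ring_nf
  have e : SS (N + 1) t - SS N t = 2 * (-(20 * π ^ 3 / 27 : ℝ) /
      ((w + (0:ℝ)) * (w + (2 * π : ℝ)) * (w + (π / 3 : ℝ)) * (w + (5 * π / 3 : ℝ)))).re := by
    have h0 := norm_pos_iff.1 (hpos 0 le_rfl)
    have h1 := norm_pos_iff.1 (hpos (2 * π) (by positivity))
    have h2 := norm_pos_iff.1 (hpos (π / 3) (by positivity))
    have h3 := norm_pos_iff.1 (hpos (5 * π / 3) (by positivity))
    have : (-(20 * π ^ 3 / 27 : ℝ) /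
      ((w + (0:ℝ)) * (w + (2 * π : ℝ)) * (w + (π / 3 : ℝ)) * (w + (5 * π / 3 : ℝ))) : ℂ) =
      1 / (w + (π / 3 : ℝ)) - 1 / (w + (5 * π / 3 : ℝ)) + (2 / 3 : ℝ) * (1 / (w + (2 * π : ℝ)) -
        1 / (w + (0:ℝ))) := by
      have q6 : w + ((2 * π : ℝ) : ℂ) = w + 6 * (π / 3) := by push_cast; ring
      have q5 : w + ((5 * π / 3 : ℝ) : ℂ) = w + 5 * (π / 3) := by push_cast; ring
      have q1 : w + ((π / 3 : ℝ) : ℂ) = w + (π / 3) := by push_cast; ring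
      have q0 : w + ((0 : ℝ) : ℂ) = w := by push_cast; ring
      rw [q6] at h1 ⊢
      rw [q5] at h3 ⊢
      rw [q1] at h2 ⊢
      rw [q0] at h0 ⊢
      have := frac_id w (π / 3) h0 h1 h2 h3
      push_cast
      rw [← this]
      ring
    rw [this]
    rw [SS, SS, Finset.sum_range_succ]
    have a1 : 2 * π * (((N + 1 : ℕ) : ℝ) + 1 / 6) = c + π / 3 := by rw [hc]; push_cast; ring
    have a2 : 2 * π * (((N + 1 : ℕ) : ℝ) + 5 / 6) = c + 5 * π / 3 := by rw [hc]; push_cast; ring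
    have a3 : 2 * π * (((N + 1 : ℕ) : ℝ) + 1) = c + 2 * π := by rw [hc]; push_cast; ring
    have a4 : kap c t = 2 * (1 / (w + (0:ℝ))).re := by rw [← hk]; simp
    rw [a1, a2, a3, a4, hk, hk, hk, Complex.add_re, Complex.sub_re, Complex.re_ofReal_mul,
      Complex.sub_re]
    ring
  rw [e, abs_mul, abs_two]
  have hn := Complex.abs_re_le_norm (-(20 * π ^ 3 / 27 : ℝ) /
      ((w + (0:ℝ)) * (w + (2 * π : ℝ)) * (w + (π / 3 : ℝ)) * (w + (5 * π / 3 : ℝ))))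
  refine (mul_le_mul_of_nonneg_left hn zero_le_two).trans ?_
  have hsq : ∀ a : ℝ, 0 ≤ a → √(c ^ 2 + t ^ 2) ≤ ‖w + a‖ := fun a ha => by
    rw [Real.sqrt_le_left (norm_nonneg _)]; exact hnw a ha
  set q := √(c ^ 2 + t ^ 2) with hq
  have hqp : 0 < q := by positivity
  have hq2 : q ^ 2 = c ^ 2 + t ^ 2 := Real.sq_sqrt (by positivity)
  have hden : q ^ 4 ≤ ‖(w + (0:ℝ)) * (w + (2 * π : ℝ)) * (w + (π / 3 : ℝ)) * (w + (5 * π / 3 : ℝ))‖ := by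
    rw [norm_mul, norm_mul, norm_mul, show q ^ 4 = q * q * q * q by ring]
    gcongr <;> exact hsq _ (by positivity)
  rw [norm_div]
  have hnum : ‖(-((20 * π ^ 3 / 27 : ℝ) : ℂ))‖ ≤ 50 := by
    rw [norm_neg, Complex.norm_real, Real.norm_eq_abs, abs_of_pos (by positivity)]
    have : π ^ 3 ≤ 4 ^ 3 := by gcongr
    linarith
  have hd2 : (N + 1 : ℝ) ^ 2 * (1 + t ^ 2) ≤ q ^ 4 := by
    rw [show q ^ 4 = q ^ 2 * q ^ 2 by ring, hq2]
    have : (N + 1 : ℝ) ^ 2 ≤ c ^ 2 := by gcongr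
    have h1 : (1 : ℝ) ≤ (N + 1 : ℝ) ^ 2 := by nlinarith [(Nat.cast_nonneg N : (0:ℝ) ≤ N)]
    gcongr <;> nlinarith [sq_nonneg t]
  calc _ ≤ 2 * (50 / ((N + 1 : ℝ) ^ 2 * (1 + t ^ 2))) := by
        gcongr
        exact hd2.trans hden
    _ = _ := by field_simp; norm_num

lemma SS_bound (N : ℕ) (t : ℝ) : |SS N t| ≤ (300 - 200 / (N + 1)) / (1 + t ^ 2) := by
  have hpi := Real.pi_gt_three
  have hpi4 := Real.pi_lt_four
  induction N with
  | zero =>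
    have h1 := kap_bound (2 * π * (1 / 6)) t (by linarith)
    have h2 := kap_bound (2 * π * (5 / 6)) t (by linarith)
    have h3 := kap_bound (2 * π) t (by linarith)
    have : SS 0 t = kap (2 * π * (1 / 6)) t - kap (2 * π * (5 / 6)) t + 2 / 3 * kap (2 * π) t := by
      simp [SS]
    rw [this]
    have hp : 0 < 1 + t ^ 2 := by positivity
    rw [le_div_iff₀ hp] at h1 h2 h3 ⊢
    have h4 : |kap (2 * π * (1 / 6)) t - kap (2 * π * (5 / 6)) t + 2 / 3 * kap (2 * π) t| ≤
      |kap (2 * π * (1 / 6)) t| + |kap (2 * π * (5 / 6)) t| + |kap (2 * π) t| := by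
      refine (abs_add_le _ _).trans (add_le_add (abs_sub _ _) ?_)
      rw [abs_mul, abs_of_pos (by norm_num : (0:ℝ) < 2 / 3)]
      linarith [abs_nonneg (kap (2 * π) t)]
    have h5 := mul_le_mul_of_nonneg_right h4 hp.le
    norm_num at *
    linarith
  | succ N ih =>
    have h := D_bound N t
    have h2 : |SS (N + 1) t| ≤ |SS N t| + |SS (N + 1) t - SS N t| := by
      have := abs_add_le (SS N t) (SS (N + 1) t - SS N t)
      simpa using this
    refine h2.trans ((add_le_add ih h).trans ?_)
    rw [← add_div]
    gcongr
    push_cast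
    have h0 : (0:ℝ) ≤ N := Nat.cast_nonneg N
    have : 100 / (N + 1 : ℝ) ^ 2 ≤ 200 / (N + 1) - 200 / (N + 1 + 1) := by
      rw [div_sub_div _ _ (by positivity) (by positivity), div_le_div_iff₀ (by positivity) (by positivity)]
      nlinarith [mul_nonneg h0 h0, mul_nonneg (mul_nonneg h0 h0) h0]
    linarith

lemma kap_tendsto (a t : ℝ) (ha : 0 ≤ a) :
    Tendsto (fun N : ℕ => kap (2 * π * (N + a)) t) atTop (𝓝 0) := by
  have hpi := Real.pi_gt_three
  refine squeeze_zero_norm' (a := fun N : ℕ => 2 * (1 / (N : ℝ))) ?_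
    (by simpa using (tendsto_one_div_atTop_nhds_zero_nat (𝕜 := ℝ)).const_mul 2)
  filter_upwards [eventually_gt_atTop 0] with N hN
  have hN' : (0:ℝ) < N := by exact_mod_cast hN
  have hc : (N : ℝ) ≤ 2 * π * (N + a) := by nlinarith
  set c := 2 * π * (N + a)
  have hcp : 0 < c := by linarith
  rw [kap, Real.norm_eq_abs, abs_of_nonneg (by positivity), mul_one_div,
    div_le_div_iff₀ (by positivity) (by positivity)]
  nlinarith [sq_nonneg t]

lemma cot_re (t : ℝ) : (Complex.cot (π * (1 / 6 + t / (2 * π) * Complex.I))).re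
    = √3 / (2 * Real.cosh t - 1) := by
  have hpi : (π : ℂ) ≠ 0 := by exact_mod_cast Real.pi_ne_zero
  have e : (π * (1 / 6 + t / (2 * π) * Complex.I) : ℂ) = ((π / 6 : ℝ) : ℂ) + ((t / 2 : ℝ) : ℂ) * Complex.I := by
    push_cast; field_simp
  rw [e, Complex.cot, Complex.cos_add_mul_I, Complex.sin_add_mul_I]
  have hc : Real.cosh t = Real.cosh (t / 2) ^ 2 + Real.sinh (t / 2) ^ 2 := by
    rw [← Real.cosh_two_mul]; ring_nf
  have hs : Real.cosh (t / 2) ^ 2 = Real.sinh (t / 2) ^ 2 + 1 := Real.cosh_sq _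
  simp only [← Complex.ofReal_cos, ← Complex.ofReal_sin, ← Complex.ofReal_cosh,
    ← Complex.ofReal_sinh, Real.cos_pi_div_six, Real.sin_pi_div_six]
  rw [hc]
  have h3 : √3 ^ 2 = 3 := Real.sq_sqrt (by norm_num)
  set C := Real.cosh (t / 2)
  set S := Real.sinh (t / 2)
  rw [Complex.div_re, Complex.normSq_apply]
  norm_num
  have d : 2 * (C ^ 2 + S ^ 2) - 1 = 4 * (1 / 2 * C * (1 / 2 * C) + √3 / 2 * S * (√3 / 2 * S)) := by
    linear_combination hs - S ^ 2 * h3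
  have hd : 0 < 2 * (C ^ 2 + S ^ 2) - 1 := by nlinarith [sq_nonneg S]
  rw [d] at hd ⊢
  have hd2 : 0 < 1 / 2 * C * (1 / 2 * C) + √3 / 2 * S * (√3 / 2 * S) := by linarith
  rw [← add_div, div_eq_div_iff hd2.ne' hd.ne']
  linear_combination √3 * (1 / 2 * C * (1 / 2 * C) + √3 / 2 * S * (√3 / 2 * S)) * hs

lemma SS_tendsto (t : ℝ) : Tendsto (fun N => SS N t) atTop (𝓝 (√3 / (2 * Real.cosh t - 1))) := by
  set x : ℂ := 1 / 6 + t / (2 * π) * Complex.I with hx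
  have hpi : (π : ℂ) ≠ 0 := by exact_mod_cast Real.pi_ne_zero
  have hpi' := Real.pi_ne_zero
  have hxre : x.re = 1 / 6 := by
    rw [hx, show (t / (2 * π) : ℂ) = ((t / (2 * π) : ℝ) : ℂ) by push_cast; rfl]
    simp [-Complex.ofReal_div, -Complex.ofReal_mul]
  have hxZ : x ∈ Complex.integerComplement := by
    rintro ⟨n, hn⟩
    have := congrArg Complex.re hn
    rw [hxre] at this
    simp at this
    have h6 : (6 * n : ℝ) = 1 := by rw [this]; norm_num
    have h7 : 6 * n = 1 := by exact_mod_cast h6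
    omega
  have h := tendsto_logDeriv_euler_cot_sub hxZ
  have h2 := (Complex.continuous_re.tendsto _).comp h
  have hk : ∀ m : ℝ, (1 / (x + m)).re = π * kap (2 * π * (m + 1 / 6)) t := by
    intro m
    rw [kap_re, ← mul_assoc, mul_comm π 2, ← Complex.re_ofReal_mul]
    congr 1
    rw [show (((2 * π * (m + 1 / 6) : ℝ) : ℂ) + t * Complex.I) = 2 * π * (x + m) by
      rw [hx]; push_cast; field_simp; ring]
    have h2p : (2 * π : ℂ) ≠ 0 := by simp
    push_cast
    rw [← div_div, ← mul_div_assoc, mul_one_div_cancel h2p]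
  have hneg : ∀ c t, kap (-c) t = - kap c t := by intro c t; simp [kap]; ring
  have hS : ∀ N, SS N t = 1 / π * ((1 / x).re + (∑ j ∈ Finset.range (N + 1), cotTerm x j).re)
      - kap (2 * π * (N + (1 + 1 / 6))) t + 2 / 3 * kap (2 * π * (N + 1)) t := by
    intro N
    have ct : ∀ j : ℕ, (cotTerm x j).re = π * (kap (2 * π * (j + 1 + 1 / 6)) t - kap (2 * π * (j + 5 / 6)) t) := by
      intro j
      have a := hk (j + 1)
      have b := hk (-(j + 1))
      rw [show 2 * π * (-((j:ℝ) + 1) + 1 / 6) = -(2 * π * (j + 5 / 6)) by ring, hneg] at b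
      rw [cotTerm, Complex.add_re]
      push_cast at a b
      rw [a, sub_eq_add_neg, b]
      ring
    rw [Complex.re_sum]
    simp_rw [ct]
    rw [← Finset.mul_sum]
    have z := hk 0
    simp only [Complex.ofReal_zero, add_zero, zero_add] at z
    rw [z, SS, ← mul_add, ← mul_assoc, one_div_mul_cancel hpi', one_mul]
    congr 1
    induction N with
    | zero => simp; ring
    | succ N ih =>
      rw [Finset.sum_range_succ, ih, Finset.sum_range_succ _ (N + 1)]
      push_cast
      ring_nf
  have lim : Tendsto (fun N : ℕ => 1 / π * ((1 / x).re + (∑ j ∈ Finset.range (N + 1), cotTerm x j).re)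
      - kap (2 * π * (N + (1 + 1 / 6))) t + 2 / 3 * kap (2 * π * (N + 1)) t) atTop
      (𝓝 (1 / π * ((1 / x).re + (π * Complex.cot (π * x) - 1 / x).re) - 0 + 2 / 3 * 0)) :=
    (((((tendsto_add_atTop_iff_nat 1).2 h2).const_add _).const_mul _).sub
      (kap_tendsto _ _ (by norm_num))).add ((kap_tendsto _ _ (by norm_num)).const_mul _)
  have ev : 1 / π * ((1 / x).re + (π * Complex.cot (π * x) - 1 / x).re) - 0 + 2 / 3 * 0 =
      √3 / (2 * Real.cosh t - 1) := by
    rw [← cot_re, Complex.sub_re, Complex.re_ofReal_mul, ← hx]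
    field_simp
    ring
  rw [ev] at lim
  exact lim.congr fun N => (hS N).symm

lemma gamma_lim : Tendsto (fun N : ℕ => π * (∑ n ∈ Finset.range (N + 1), (Real.log (2 * π * (n + 1 / 6)) -
      Real.log (2 * π * (n + 5 / 6))) + 2 / 3 * Real.log (2 * π * (N + 1)))) atTop
      (𝓝 (π / 3 * Real.log (4 * π ^ 2 * Real.Gamma (5/6) ^ 3 / Real.Gamma (1/6) ^ 3))) := by
  have g1 : 0 < Real.Gamma (1 / 6) := Real.Gamma_pos_of_pos (by norm_num)
  have g5 : 0 < Real.Gamma (5 / 6) := Real.Gamma_pos_of_pos (by norm_num)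
  have h1 := ((Real.GammaSeq_tendsto_Gamma (1 / 6)).log g1.ne')
  have h5 := ((Real.GammaSeq_tendsto_Gamma (5 / 6)).log g5.ne')
  have hl : Tendsto (fun N : ℕ => Real.log (((N + 1 : ℕ) : ℝ) / N)) atTop (𝓝 0) := by
    have : Tendsto (fun N : ℕ => (((N + 1 : ℕ) : ℝ) / N)) atTop (𝓝 1) := by
      have := (tendsto_one_div_atTop_nhds_zero_nat (𝕜 := ℝ)).const_add 1
      rw [add_zero] at this
      refine this.congr' ?_
      filter_upwards [eventually_gt_atTop 0] with N hN
      have hN' : (0:ℝ) < N := by exact_mod_cast hN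
      push_cast; field_simp
    simpa using this.log one_ne_zero
  have key := (((h5.sub h1).add (hl.const_mul (2 / 3))).add_const (2 / 3 * Real.log (2 * π))).const_mul π
  have ev : π * (Real.log (Real.Gamma (5 / 6)) - Real.log (Real.Gamma (1 / 6)) + 2 / 3 * 0
      + 2 / 3 * Real.log (2 * π)) =
      π / 3 * Real.log (4 * π ^ 2 * Real.Gamma (5/6) ^ 3 / Real.Gamma (1/6) ^ 3) := by
    rw [Real.log_div (by positivity) (by positivity), Real.log_mul (x := 4 * π ^ 2) (by positivity) (by positivity),
      show 4 * π ^ 2 = (2 * π) ^ 2 by ring, Real.log_pow, Real.log_pow, Real.log_pow]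
    push_cast; ring
  rw [ev] at key
  refine key.congr' ?_
  filter_upwards [eventually_gt_atTop 0] with N hN
  have hN' : (0:ℝ) < N := by exact_mod_cast hN
  have gs : ∀ s : ℝ, 0 < s → Real.log (Real.GammaSeq s N) = s * Real.log N + Real.log (N.factorial)
      - ∑ j ∈ Finset.range (N + 1), Real.log (j + s) := by
    intro s hs
    have hf : (0:ℝ) < N.factorial := by exact_mod_cast N.factorial_pos
    have hp : ∀ j ∈ Finset.range (N + 1), s + (j:ℝ) ≠ 0 := fun j _ => by positivity
    rw [Real.GammaSeq, Real.log_div (by positivity) (Finset.prod_ne_zero_iff.2 hp),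
      Real.log_mul (by positivity) hf.ne', Real.log_rpow hN', Real.log_prod hp]
    simp_rw [add_comm s]
  rw [gs _ (by norm_num), gs _ (by norm_num), Real.log_div (by positivity) hN'.ne']
  have lm : ∀ y : ℝ, 0 < y → Real.log (2 * π * y) = Real.log (2 * π) + Real.log y :=
    fun y hy => Real.log_mul (by positivity) hy.ne'
  have hs : ∀ n : ℕ, Real.log (2 * π * (n + 1 / 6)) - Real.log (2 * π * (n + 5 / 6)) =
      Real.log (n + 1 / 6) - Real.log (n + 5 / 6) := by
    intro n
    rw [lm _ (by positivity), lm _ (by positivity)]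
    ring
  simp_rw [hs]
  rw [Finset.sum_sub_distrib, lm _ (by positivity)]
  push_cast
  ring

lemma integral_cosh : ∫ t in Set.Ioi (0:ℝ), Real.log t * (√3 / (2 * Real.cosh t - 1)) =
    π / 3 * Real.log (4 * π ^ 2 * Real.Gamma (5/6) ^ 3 / Real.Gamma (1/6) ^ 3) := by
  have hd : Tendsto (fun N : ℕ => ∫ t in Set.Ioi (0:ℝ), Real.log t * SS N t) atTop
      (𝓝 (∫ t in Set.Ioi (0:ℝ), Real.log t * (√3 / (2 * Real.cosh t - 1)))) := by
    refine tendsto_integral_of_dominated_convergence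
      (fun t => 300 * ‖Real.log t / (1 + t ^ 2)‖) ?_ (int_log_base.norm.const_mul 300) ?_ ?_
    · intro N
      apply Measurable.aestronglyMeasurable
      unfold SS kap
      fun_prop
    · intro N
      refine ae_of_all _ fun t => ?_
      rw [norm_mul, norm_div, Real.norm_eq_abs (1 + t ^ 2), abs_of_pos (by positivity : 0 < 1 + t ^ 2)]
      have h := SS_bound N t
      have h2 : (300 - 200 / ((N:ℝ) + 1)) / (1 + t ^ 2) ≤ 300 / (1 + t ^ 2) := by
        gcongr
        have : 0 ≤ 200 / ((N:ℝ) + 1) := by positivity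
        linarith
      calc ‖Real.log t‖ * ‖SS N t‖ ≤ ‖Real.log t‖ * (300 / (1 + t ^ 2)) := by
            gcongr; exact h.trans h2
        _ = _ := by ring
    · exact ae_of_all _ fun t => (SS_tendsto t).const_mul _
  simp_rw [integral_SS] at hd
  exact tendsto_nhds_unique hd gamma_lim

theorem stmt1 :
    ∫ x in Set.Ioi (1:ℝ), Real.log (Real.log x) / (1 - x + x ^ 2) =
      (π / (3 * Real.sqrt 3)) *
        Real.log (4 * π ^ 2 * Real.Gamma (5/6) ^ 3 / Real.Gamma (1/6) ^ 3) := by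
  have him : Real.exp '' Set.Ioi 0 = Set.Ioi 1 := by
    ext y
    simp only [Set.mem_image, Set.mem_Ioi]
    constructor
    · rintro ⟨x, hx, rfl⟩
      exact Real.one_lt_exp_iff.2 hx
    · intro hy
      exact ⟨Real.log y, Real.log_pos hy, Real.exp_log (by linarith)⟩
  have h3 : 0 < √3 := by positivity
  rw [← him, integral_image_eq_integral_abs_deriv_smul measurableSet_Ioi
    (fun x _ => (Real.hasDerivAt_exp x).hasDerivWithinAt) Real.exp_injective.injOn]
  have e : ∀ t : ℝ, |Real.exp t| • (Real.log (Real.log (Real.exp t)) / (1 - Real.exp t + Real.exp t ^ 2))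
      = (√3)⁻¹ * (Real.log t * (√3 / (2 * Real.cosh t - 1))) := by
    intro t
    have hp := Real.exp_pos t
    rw [Real.log_exp, abs_of_pos hp, Real.cosh_eq, Real.exp_neg, smul_eq_mul]
    have h1 : 1 - Real.exp t + Real.exp t ^ 2 ≠ 0 := by nlinarith [sq_nonneg (Real.exp t - 1)]
    have : 2 * ((Real.exp t + (Real.exp t)⁻¹) / 2) - 1 = (1 - Real.exp t + Real.exp t ^ 2) / Real.exp t := by
      field_simp; ring
    rw [this]
    field_simp
  simp_rw [e]
  rw [integral_const_mul, integral_cosh]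
  field_simp
end

section
/- ∫₁^∞ log(log(x)) / (1 + x + x²) dx = (π/√3) · log( (2π)^{1/3} Γ(2/3) / Γ(1/3) ). -/
open MeasureTheory Real

noncomputable def LL (a u : ℝ) : ℝ := 2 * a / (u ^ 2 + a ^ 2)
noncomputable def TT (k : ℕ) (u : ℝ) : ℝ :=
  LL (k + 1/3) u - LL (k + 2/3) u + (1/3) * (LL (k + 1) u - LL k u)

lemma TT_sum (N : ℕ) (u : ℝ) : ∑ k ∈ Finset.range N, TT k u =
    ∑ k ∈ Finset.range N, (LL (k + 1/3) u - LL (k + 2/3) u) + (1/3) * LL N u := by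
  induction N with
  | zero => simp [LL]
  | succ n ih =>
    rw [Finset.sum_range_succ, ih, Finset.sum_range_succ]
    simp only [TT]; push_cast; ring

lemma TT_bound (k : ℕ) (u : ℝ) (hu : 0 < u) :
    |TT k u| ≤ 100 / (((k:ℝ) + 1) ^ 2) * (1 / (1 + u ^ 2)) := by
  have hx : 0 < u ^ 2 := by positivity
  unfold TT LL
  generalize u ^ 2 = x at hx
  rcases k with _ | j
  · simp only [Nat.cast_zero]
    rw [abs_le]
    constructor
    · rw [← sub_nonneg]
      have : 0 ≤ (x) := hx.le
      field_simp
      ring_nf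
      positivity
    · rw [← sub_nonneg]
      field_simp
      ring_nf
      positivity
  · push_cast
    have hj : (0:ℝ) ≤ j := Nat.cast_nonneg j
    generalize (j:ℝ) = y at hj
    rw [abs_le]
    constructor
    · rw [← sub_nonneg]
      field_simp
      ring_nf
      positivity
    · rw [← sub_nonneg]
      field_simp
      ring_nf
      positivity

lemma LL_complex (a u : ℝ) (ha : 0 < a) :
    ((LL a u : ℝ) : ℂ) = 1 / (a + u * Complex.I) + 1 / (a - u * Complex.I) := by
  have h1 : (a + u * Complex.I : ℂ) ≠ 0 := by
    intro h; have := congrArg Complex.re h; simp at this; exact ha.ne' this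
  have h2 : (a - u * Complex.I : ℂ) ≠ 0 := by
    intro h; have := congrArg Complex.re h; simp at this; exact ha.ne' this
  have h3 : (u ^ 2 + a ^ 2 : ℂ) = (a + u * Complex.I) * (a - u * Complex.I) := by
    ring_nf; simp
  unfold LL
  push_cast
  rw [h3]
  field_simp
  ring

lemma cot_partial (u : ℝ) (z w : ℂ) (hz : z = 1/3 + u * Complex.I) (hw : w = 1/3 - u * Complex.I)
    (N : ℕ) :
    (∑ j ∈ Finset.range N, cotTerm z j + 1 / z) + (∑ j ∈ Finset.range N, cotTerm w j + 1 / w) =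
    (((∑ k ∈ Finset.range N, (LL (k + 1/3) u - LL (k + 2/3) u)) + LL (N + 1/3) u : ℝ) : ℂ) := by
  induction N with
  | zero =>
    have := LL_complex (1/3) u (by norm_num)
    push_cast at this
    simp only [Finset.range_zero, Finset.sum_empty, Nat.cast_zero, zero_add]
    rw [this, hz, hw]
  | succ n ih =>
    have e1 := LL_complex (n + 1 + 1/3) u (by positivity)
    have e2 := LL_complex (n + 2/3) u (by positivity)
    rw [Finset.sum_range_succ, Finset.sum_range_succ, Finset.sum_range_succ]
    push_cast at ih e1 e2 ⊢
    have h1 : 1 / (z - (n + 1)) = - (1 / ((n:ℂ) + 2/3 - u * Complex.I)) := by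
      rw [hz, ← one_div_neg_eq_neg_one_div]; congr 1; ring
    have h2 : 1 / (w - (n + 1)) = - (1 / ((n:ℂ) + 2/3 + u * Complex.I)) := by
      rw [hw, ← one_div_neg_eq_neg_one_div]; congr 1; ring
    have h3 : z + (n + 1) = (n:ℂ) + 1 + 1/3 + u * Complex.I := by rw [hz]; ring
    have h4 : w + (n + 1) = (n:ℂ) + 1 + 1/3 - u * Complex.I := by rw [hw]; ring
    simp only [cotTerm]
    rw [e1, e2, h1, h2, h3, h4]
    simp only [cotTerm] at ih
    linear_combination ih

lemma LL_tendsto (u : ℝ) (c : ℝ) (hu : 0 < u) :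
    Filter.Tendsto (fun n : ℕ => LL (n + c) u) Filter.atTop (nhds 0) := by
  have h1 : Filter.Tendsto (fun n : ℕ => ((n:ℝ) + c)) Filter.atTop Filter.atTop :=
    Filter.tendsto_atTop_add_const_right _ _ tendsto_natCast_atTop_atTop
  have h2 := (tendsto_inv_atTop_zero.comp h1).const_mul 2
  rw [mul_zero] at h2
  refine squeeze_zero' ?_ ?_ h2
  · filter_upwards [h1.eventually_gt_atTop 0] with n hn
    unfold LL; positivity
  · filter_upwards [h1.eventually_gt_atTop 0] with n hn
    simp only [Function.comp, LL]
    generalize (n:ℝ) + c = a at hn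
    rw [← div_eq_mul_inv, div_le_div_iff₀ (by positivity) hn]
    nlinarith [sq_nonneg u]

lemma cot_val (u : ℝ) (z w : ℂ) (hz : z = 1/3 + u * Complex.I) (hw : w = 1/3 - u * Complex.I)
    (hz' : z ∈ Complex.integerComplement) (hw' : w ∈ Complex.integerComplement) :
    (π * Complex.cot (π * z) + π * Complex.cot (π * w) : ℂ) =
      ((2 * √3 * π / (1 + 2 * Real.cosh (2 * π * u)) : ℝ) : ℂ) := by
  have s1 := sin_pi_mul_ne_zero hz'
  have s2 := sin_pi_mul_ne_zero hw'
  have hs : Complex.sin (π * z + π * w) = ((√3 / 2 : ℝ) : ℂ) := by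
    have : (π * z + π * w : ℂ) = ((π - π / 3 : ℝ) : ℂ) := by rw [hz, hw]; push_cast; ring
    rw [this, ← Complex.ofReal_sin, Real.sin_pi_sub, Real.sin_pi_div_three]
  have hc : Complex.cos (π * z + π * w) = ((-1 / 2 : ℝ) : ℂ) := by
    have : (π * z + π * w : ℂ) = ((π - π / 3 : ℝ) : ℂ) := by rw [hz, hw]; push_cast; ring
    rw [this, ← Complex.ofReal_cos, Real.cos_pi_sub, Real.cos_pi_div_three]; norm_num
  have hd : Complex.cos (π * z - π * w) = ((Real.cosh (2 * π * u) : ℝ) : ℂ) := by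
    have : (π * z - π * w : ℂ) = ((2 * π * u : ℝ) : ℂ) * Complex.I := by
      rw [hz, hw]; push_cast; ring
    rw [this, Complex.cos_mul_I, Complex.ofReal_cosh]
  rw [Complex.sin_add] at hs
  rw [Complex.cos_add] at hc
  rw [Complex.cos_sub] at hd
  have hpos : (1 + 2 * Real.cosh (2 * π * u)) ≠ 0 := by
    have := Real.cosh_pos (2 * π * u); positivity
  have hpos' : (1 + 2 * ((Real.cosh (2 * π * u) : ℝ) : ℂ)) ≠ 0 := by exact_mod_cast hpos
  have hss : 4 * (Complex.sin (π * z) * Complex.sin (π * w)) =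
      1 + 2 * ((Real.cosh (2 * π * u) : ℝ) : ℂ) := by
    push_cast at hc hd ⊢
    linear_combination 2 * hd - 2 * hc
  have hfin : (π * Complex.cot (π * z) + π * Complex.cot (π * w) : ℂ) =
      4 * π * (√3 / 2 : ℝ) / (4 * (Complex.sin (π * z) * Complex.sin (π * w))) := by
    rw [← hs]; unfold Complex.cot; field_simp; ring
  rw [hfin, hss]; push_cast; congr 1; ring

lemma S_tendsto (u : ℝ) (hu : 0 < u) :
    Filter.Tendsto (fun N : ℕ => ∑ k ∈ Finset.range N, TT k u) Filter.atTop
      (nhds (2 * √3 * π / (1 + 2 * Real.cosh (2 * π * u)))) := by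
  obtain ⟨z, hz⟩ : ∃ z : ℂ, z = 1/3 + u * Complex.I := ⟨_, rfl⟩
  obtain ⟨w, hw⟩ : ∃ w : ℂ, w = 1/3 - u * Complex.I := ⟨_, rfl⟩
  have hz' : z ∈ Complex.integerComplement := by
    rintro ⟨n, hn⟩
    have := congrArg Complex.im hn; simp [hz] at this; exact hu.ne this
  have hw' : w ∈ Complex.integerComplement := by
    rintro ⟨n, hn⟩
    have := congrArg Complex.im hn; simp [hw] at this; exact hu.ne' this
  have h1 := ((tendsto_logDeriv_euler_cot_sub hz').add_const (1 / z)).add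
    ((tendsto_logDeriv_euler_cot_sub hw').add_const (1 / w))
  simp only [cot_partial u z w hz hw, sub_add_cancel] at h1
  rw [cot_val u z w hz hw hz' hw'] at h1
  have h2 := (Complex.continuous_re.tendsto _).comp h1
  simp only [Function.comp_def, Complex.ofReal_re] at h2
  have h3 := (h2.sub (LL_tendsto u (1/3) hu)).add ((LL_tendsto u 0 hu).const_mul (1/3))
  simp only [sub_zero, mul_zero, add_zero] at h3
  refine h3.congr fun N => ?_
  rw [TT_sum]; ring

lemma int_log_aux : IntegrableOn (fun t : ℝ => Real.log t * (1 / (1 + t ^ 2))) (Set.Ioi 0) := by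
  have hm : ∀ s : Set ℝ, AEStronglyMeasurable (fun t : ℝ => Real.log t * (1 / (1 + t ^ 2)))
      (volume.restrict s) := fun s => by
    apply Measurable.aestronglyMeasurable; fun_prop
  rw [← Set.Ioc_union_Ioi_eq_Ioi (zero_le_one (α := ℝ))]
  refine IntegrableOn.union ?_ ?_
  · have h : IntegrableOn Real.log (Set.Ioc 0 1) :=
      (intervalIntegrable_iff_integrableOn_Ioc_of_le zero_le_one).1
        intervalIntegral.intervalIntegrable_log'
    refine Integrable.mono h (hm _) (Filter.Eventually.of_forall fun t => ?_)
    rw [norm_mul]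
    refine mul_le_of_le_one_right (norm_nonneg _) ?_
    rw [Real.norm_of_nonneg (by positivity), div_le_one (by positivity)]
    nlinarith [sq_nonneg t]
  · have h : IntegrableOn (fun t : ℝ => 2 * t ^ (-(3/2) : ℝ)) (Set.Ioi 1) :=
      (integrableOn_Ioi_rpow_of_lt (by norm_num) one_pos).const_mul 2
    refine Integrable.mono' h (hm _) ?_
    filter_upwards [ae_restrict_mem measurableSet_Ioi] with t ht
    have ht : 1 < t := ht
    have ht0 : 0 < t := by linarith
    rw [Real.norm_of_nonneg (mul_nonneg (Real.log_nonneg ht.le) (by positivity))]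
    have h1 := Real.log_le_rpow_div ht0.le (show (0:ℝ) < 1/2 by norm_num)
    have h2 : (1:ℝ) / (1 + t ^ 2) ≤ t ^ (-2 : ℝ) := by
      rw [Real.rpow_neg ht0.le, ← one_div]
      have : t ^ (2:ℝ) = t ^ 2 := by exact_mod_cast Real.rpow_natCast t 2
      rw [this]
      exact one_div_le_one_div_of_le (by positivity) (by linarith)
    calc _ ≤ (t ^ (1/2 : ℝ) / (1/2)) * t ^ (-2 : ℝ) := by gcongr
      _ = 2 * (t ^ (1/2 : ℝ) * t ^ (-2 : ℝ)) := by ring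
      _ = _ := by rw [← Real.rpow_add ht0]; norm_num

lemma int_inv_aux : IntegrableOn (fun t : ℝ => 1 / (1 + t ^ 2)) (Set.Ioi 0) := by
  simpa only [one_div] using integrable_inv_one_add_sq.integrableOn

lemma integral_log_aux : ∫ t in Set.Ioi (0:ℝ), Real.log t * (1 / (1 + t ^ 2)) = 0 := by
  have h := integral_comp_rpow_Ioi (fun t : ℝ => Real.log t * (1 / (1 + t ^ 2)))
    (show (-1:ℝ) ≠ 0 by norm_num)
  have h2 : ∫ x in Set.Ioi (0:ℝ), (|(-1:ℝ)| * x ^ ((-1:ℝ) - 1)) •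
      (Real.log (x ^ (-1:ℝ)) * (1 / (1 + (x ^ (-1:ℝ)) ^ 2))) =
      ∫ x in Set.Ioi (0:ℝ), -(Real.log x * (1 / (1 + x ^ 2))) := by
    refine setIntegral_congr_fun measurableSet_Ioi fun x hx => ?_
    have hx : 0 < x := hx
    have e : x ^ ((-1:ℝ) - 1) = (x ^ 2)⁻¹ := by
      rw [show (-1:ℝ) - 1 = -2 by norm_num, Real.rpow_neg hx.le]
      congr 1; exact_mod_cast Real.rpow_natCast x 2
    simp only [e, Real.rpow_neg_one, Real.log_inv, abs_neg, abs_one, smul_eq_mul]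
    field_simp
    ring
  rw [h2, integral_neg] at h
  linarith

lemma integrable_loglin (c : ℝ) :
    IntegrableOn (fun t : ℝ => (c + Real.log t) * (1 / (1 + t ^ 2))) (Set.Ioi 0) := by
  simp only [add_mul]
  exact (int_inv_aux.const_mul c).add int_log_aux

lemma integral_loglin (c : ℝ) :
    ∫ t in Set.Ioi (0:ℝ), (c + Real.log t) * (1 / (1 + t ^ 2)) = c * (π / 2) := by
  simp only [add_mul]
  rw [integral_add (int_inv_aux.const_mul c) int_log_aux, integral_log_aux, integral_const_mul]
  simp only [one_div, integral_Ioi_inv_one_add_sq]; simp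

lemma integral_LL (a : ℝ) (ha : 0 < a) :
    ∫ u in Set.Ioi (0:ℝ), Real.log (2 * π * u) * LL a u = π * Real.log (2 * π * a) := by
  have h := integral_comp_mul_left_Ioi' (fun u => Real.log (2 * π * u) * LL a u) 0 ha
  rw [mul_zero] at h
  rw [← h]
  have h2 : ∫ x in Set.Ioi (0:ℝ), Real.log (2 * π * (a * x)) * LL a (a * x) =
      ∫ x in Set.Ioi (0:ℝ), (2 / a) * ((Real.log (2 * π * a) + Real.log x) * (1 / (1 + x ^ 2))) := by
    refine setIntegral_congr_fun measurableSet_Ioi fun x hx => ?_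
    have hx : 0 < x := hx
    have hp := Real.pi_pos
    have : Real.log (2 * π * (a * x)) = Real.log (2 * π * a) + Real.log x := by
      rw [← Real.log_mul (by positivity) hx.ne']; congr 1; ring
    simp only [this, LL]
    field_simp
    ring
  rw [h2, integral_const_mul, integral_loglin, smul_eq_mul]
  field_simp

lemma integrable_LL (a : ℝ) (ha : 0 < a) :
    IntegrableOn (fun u => Real.log (2 * π * u) * LL a u) (Set.Ioi 0) := by
  have hp := Real.pi_pos
  have h := (integrable_loglin (Real.log (2 * π))).norm.const_mul (2 * a * (1 + 1 / a ^ 2))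
  refine Integrable.mono' h ?_ ?_
  · apply Measurable.aestronglyMeasurable; unfold LL; fun_prop
  · filter_upwards [ae_restrict_mem measurableSet_Ioi] with x hx
    have hx : 0 < x := hx
    rw [Real.log_mul (by positivity) hx.ne', norm_mul, norm_mul, mul_left_comm]
    gcongr
    rw [Real.norm_of_nonneg (by unfold LL; positivity), Real.norm_of_nonneg (by positivity)]
    unfold LL
    rw [mul_one_div, div_le_div_iff₀ (by positivity) (by positivity)]
    rw [mul_assoc (2 * a)]
    gcongr
    have : (1 + 1 / a ^ 2) * (x ^ 2 + a ^ 2) = 1 + x ^ 2 + a ^ 2 + x ^ 2 / a ^ 2 := by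
      field_simp; ring
    rw [this]
    have : 0 ≤ x ^ 2 / a ^ 2 := by positivity
    nlinarith [sq_nonneg a]

lemma integral_S (n : ℕ) :
    ∫ u in Set.Ioi (0:ℝ), Real.log (2 * π * u) * ∑ k ∈ Finset.range (n + 1), TT k u =
    π * (∑ k ∈ Finset.range (n + 1), (Real.log (1/3 + k) - Real.log (2/3 + k))
      + (1/3) * Real.log (2 * π * (n + 1))) := by
  have hp := Real.pi_pos
  simp only [TT_sum, mul_add, Finset.mul_sum, mul_sub, Nat.cast_add, Nat.cast_one]
  have hi : ∀ k : ℕ, Integrable (fun u => Real.log (2 * π * u) * LL (k + 1/3) u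
      - Real.log (2 * π * u) * LL (k + 2/3) u) (volume.restrict (Set.Ioi 0)) := fun k =>
    (integrable_LL _ (by positivity)).sub (integrable_LL _ (by positivity))
  have e : ∀ u : ℝ, Real.log (2 * π * u) * (1/3 * LL ((n:ℝ) + 1) u) =
      1/3 * (Real.log (2 * π * u) * LL ((n:ℝ) + 1) u) := fun u => by ring
  simp only [e]
  rw [integral_add (integrable_finsetSum _ fun k _ => hi k)
      ((integrable_LL _ (by positivity)).const_mul _),
    integral_finsetSum _ fun k _ => hi k, integral_const_mul, integral_LL _ (by positivity)]
  congr 1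
  · refine Finset.sum_congr rfl fun k _ => ?_
    rw [integral_sub (integrable_LL _ (by positivity)) (integrable_LL _ (by positivity)),
      integral_LL _ (by positivity), integral_LL _ (by positivity),
      Real.log_mul (x := 2 * π) (y := (k:ℝ) + 1/3) (by positivity) (by positivity),
      Real.log_mul (x := 2 * π) (y := (k:ℝ) + 2/3) (by positivity) (by positivity),
      add_comm (k:ℝ) (1/3), add_comm (k:ℝ) (2/3)]
    ring
  · rw [← mul_add]; ring

lemma lim_dom : Filter.Tendsto (fun n : ℕ => ∫ u in Set.Ioi (0:ℝ), Real.log (2 * π * u) *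
      ∑ k ∈ Finset.range (n + 1), TT k u) Filter.atTop
    (nhds (∫ u in Set.Ioi (0:ℝ), Real.log (2 * π * u) *
      (2 * √3 * π / (1 + 2 * Real.cosh (2 * π * u))))) := by
  have hp := Real.pi_pos
  have hsum : Summable (fun k : ℕ => 100 / (((k:ℝ) + 1) ^ 2)) := by
    have := (summable_nat_add_iff 1).2 (Real.summable_one_div_nat_pow.2 one_lt_two)
    refine (this.mul_left 100).congr fun k => ?_
    push_cast; ring
  have h := (integrable_loglin (Real.log (2 * π))).norm.const_mul
    (∑' k : ℕ, 100 / (((k:ℝ) + 1) ^ 2))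
  refine tendsto_integral_of_dominated_convergence _ ?_ h ?_ ?_
  · intro n
    apply Measurable.aestronglyMeasurable; unfold TT LL; fun_prop
  · intro n
    filter_upwards [ae_restrict_mem measurableSet_Ioi] with x hx
    have hx : 0 < x := hx
    rw [Real.log_mul (by positivity) hx.ne', norm_mul, norm_mul, mul_left_comm]
    gcongr
    rw [Real.norm_of_nonneg (show 0 ≤ 1 / (1 + x ^ 2) by positivity)]
    refine (norm_sum_le _ _).trans ?_
    refine (Finset.sum_le_sum fun k _ => TT_bound k x hx).trans ?_
    rw [← Finset.sum_mul]
    gcongr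
    exact hsum.sum_le_tsum _ (fun k _ => by positivity)
  · filter_upwards [ae_restrict_mem measurableSet_Ioi] with x hx
    exact ((Filter.tendsto_add_atTop_iff_nat 1).2 (S_tendsto x hx)).const_mul _

lemma lim_gamma : Filter.Tendsto (fun n : ℕ =>
    π * (∑ k ∈ Finset.range (n + 1), (Real.log (1/3 + k) - Real.log (2/3 + k))
      + (1/3) * Real.log (2 * π * (n + 1)))) Filter.atTop
    (nhds (π * Real.log ((2 * π) ^ ((1:ℝ)/3) * Real.Gamma (2/3) / Real.Gamma (1/3)))) := by
  have hp := Real.pi_pos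
  have h1 := Real.BohrMollerup.tendsto_log_gamma (show (0:ℝ) < 1/3 by norm_num)
  have h2 := Real.BohrMollerup.tendsto_log_gamma (show (0:ℝ) < 2/3 by norm_num)
  have h3 := (((h2.sub h1).add (Real.tendsto_log_nat_add_one_sub_log.const_mul
    (1/3))).add_const (1/3 * Real.log (2 * π))).const_mul π
  have g1 := Real.Gamma_pos_of_pos (show (0:ℝ) < 1/3 by norm_num)
  have g2 := Real.Gamma_pos_of_pos (show (0:ℝ) < 2/3 by norm_num)
  rw [Real.log_div (by positivity) (by positivity), Real.log_mul (by positivity) (by positivity),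
    Real.log_rpow (by positivity)]
  convert h3 using 2
  · rw [Real.log_mul (by positivity) (by positivity)]
    simp only [Real.BohrMollerup.logGammaSeq, Finset.sum_sub_distrib]
    ring
  · ring

lemma subst_exp : ∫ x in Set.Ioi (1:ℝ), Real.log (Real.log x) / (1 + x + x ^ 2) =
    ∫ t in Set.Ioi (0:ℝ), Real.log t / (1 + 2 * Real.cosh t) := by
  have him : Set.image Real.exp (Set.Ioi 0) = Set.Ioi 1 := by
    ext y; constructor
    · rintro ⟨x, hx, rfl⟩; exact Real.one_lt_exp_iff.2 hx
    · intro hy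
      have hy : 1 < y := hy
      exact ⟨Real.log y, Real.log_pos hy, Real.exp_log (by linarith)⟩
  rw [← him, integral_image_eq_integral_abs_deriv_smul measurableSet_Ioi
    (fun x _ => (Real.hasDerivAt_exp x).hasDerivWithinAt) Real.exp_injective.injOn]
  refine setIntegral_congr_fun measurableSet_Ioi fun t ht => ?_
  have he := Real.exp_pos t
  simp only [Real.log_exp, abs_of_pos he, smul_eq_mul, Real.cosh_eq, Real.exp_neg]
  have : 1 + 2 * ((Real.exp t + (Real.exp t)⁻¹) / 2) = (1 + Real.exp t + Real.exp t ^ 2) / Real.exp t := by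
    field_simp; ring
  rw [this]
  field_simp

theorem stmt3 :
    ∫ x in Set.Ioi (1:ℝ), Real.log (Real.log x) / (1 + x + x ^ 2) =
      (π / Real.sqrt 3) *
        Real.log ((2 * π) ^ ((1:ℝ)/3) * Real.Gamma (2/3) / Real.Gamma (1/3)) := by
  have hp := Real.pi_pos
  have h1 := lim_dom
  simp only [integral_S] at h1
  have h2 := tendsto_nhds_unique h1 lim_gamma
  have h3 := integral_comp_mul_left_Ioi' (fun t => Real.log t / (1 + 2 * Real.cosh t)) 0
    (show 0 < 2 * π by positivity)
  rw [mul_zero] at h3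
  rw [subst_exp, ← h3, smul_eq_mul]
  have h4 : ∀ u : ℝ, Real.log (2 * π * u) * (2 * √3 * π / (1 + 2 * Real.cosh (2 * π * u))) =
      (√3 * (2 * π)) * (Real.log (2 * π * u) / (1 + 2 * Real.cosh (2 * π * u))) := fun u => by
    ring
  simp only [h4] at h2
  rw [integral_const_mul, mul_assoc] at h2
  have hs : 0 < √(3:ℝ) := by positivity
  rw [div_mul_eq_mul_div, ← h2]
  field_simp
end

section
/- ∫₀^{π/2} log(log(tan(t))) dt, interpreted as the integral over (π/4, π/2) where tan t > 1 plus the (complex-valued) continuation, has real part equal to ∫_{π/4}^{π/2} log(log(tan t)) dt = (π/2) · log( √(2π) Γ(3/4) / Γ(1/4) ). -/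
open MeasureTheory Real

noncomputable def vh (c u : ℝ) : ℝ := c / (c ^ 2 + u ^ 2)
noncomputable def vD (u : ℝ) : ℝ := min 1 (u ^ (-(3/2) : ℝ))

lemma vD_int : IntegrableOn (fun u => Real.log u * vD u) (Set.Ioi 0) := by
  have hm : Measurable (fun u => Real.log u * vD u) := by
    unfold vD; fun_prop
  rw [← Set.Ioc_union_Ioi_eq_Ioi (zero_le_one' ℝ)]
  refine IntegrableOn.union ?_ ?_
  · have h1 : IntegrableOn Real.log (Set.Ioc 0 1) := by
      have := intervalIntegral.intervalIntegrable_log' (a := 0) (b := 1)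
      rwa [intervalIntegrable_iff_integrableOn_Ioc_of_le zero_le_one] at this
    refine Integrable.mono h1 hm.aestronglyMeasurable ?_
    filter_upwards [ae_restrict_mem measurableSet_Ioc] with u hu
    rw [norm_mul]
    have h2 : 0 ≤ vD u := le_min zero_le_one (rpow_nonneg hu.1.le _)
    have h3 : vD u ≤ 1 := min_le_left _ _
    rw [Real.norm_of_nonneg h2]
    exact mul_le_of_le_one_right (norm_nonneg _) h3
  · have h1 := (integrableOn_Ioi_rpow_of_lt (a := -(5/4)) (by norm_num) one_pos).const_mul 4
    refine Integrable.mono' h1 hm.aestronglyMeasurable ?_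
    filter_upwards [ae_restrict_mem measurableSet_Ioi] with u hu
    have hu1 : (1:ℝ) < u := hu
    have hu0 : (0:ℝ) < u := by linarith
    have h2 : 0 ≤ vD u := le_min zero_le_one (rpow_nonneg hu0.le _)
    have h3 : vD u ≤ u ^ (-(3/2) : ℝ) := min_le_right _ _
    have h4 := Real.log_le_rpow_div hu0.le (ε := 1/4) (by norm_num)
    rw [norm_mul, Real.norm_of_nonneg h2, Real.norm_of_nonneg (Real.log_nonneg hu1.le)]
    calc Real.log u * vD u ≤ (u ^ (1/4:ℝ) / (1/4)) * u ^ (-(3/2) : ℝ) := by gcongr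
      _ = 4 * (u ^ (1/4:ℝ) * u ^ (-(3/2) : ℝ)) := by ring
      _ = _ := by rw [← rpow_add hu0]; norm_num

lemma vD_pos {u : ℝ} (hu : 0 < u) : 0 < vD u := lt_min one_pos (rpow_pos_of_pos hu _)

lemma vh_nonneg {c : ℝ} (hc : 0 < c) (u : ℝ) : 0 ≤ vh c u := by unfold vh; positivity

lemma vh_le {c u : ℝ} (hc : 0 < c) (hu : 0 < u) : vh c u ≤ (c + 1 / c) * vD u := by
  have hc' : 0 < 1 / c := by positivity
  rcases le_total u 1 with h | h
  · have : vD u = 1 := min_eq_left (by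
      rw [rpow_neg hu.le]; exact (one_le_inv₀ (rpow_pos_of_pos hu _)).2 (rpow_le_one hu.le h (by norm_num)))
    rw [this, mul_one]
    have : vh c u ≤ 1 / c := by
      unfold vh
      rw [div_le_div_iff₀ (by positivity) hc]; nlinarith [sq_nonneg u]
    linarith
  · have : vD u = u ^ (-(3/2) : ℝ) := min_eq_right (rpow_le_one_of_one_le_of_nonpos h (by norm_num))
    rw [this]
    have h1 : u ^ (-2:ℝ) ≤ u ^ (-(3/2) : ℝ) := rpow_le_rpow_of_exponent_le h (by norm_num)
    have h2 : vh c u ≤ c * u ^ (-2:ℝ) := by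
      rw [rpow_neg hu.le, rpow_two]
      unfold vh
      rw [div_eq_mul_inv]
      gcongr
      nlinarith
    have h3 : 0 < u ^ (-(3/2) : ℝ) := rpow_pos_of_pos hu _
    nlinarith

lemma vh_meas (c : ℝ) : Measurable (fun u => Real.log u * vh c u) := by
  unfold vh; fun_prop

lemma vh_int {c : ℝ} (hc : 0 < c) : IntegrableOn (fun u => Real.log u * vh c u) (Set.Ioi 0) := by
  refine Integrable.mono (vD_int.const_mul (c + 1 / c)) (vh_meas c).aestronglyMeasurable ?_
  filter_upwards [ae_restrict_mem measurableSet_Ioi] with u hu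
  rw [norm_mul, norm_mul, norm_mul, Real.norm_of_nonneg (vh_nonneg hc u), Real.norm_of_nonneg (vD_pos hu).le,
    Real.norm_of_nonneg (by positivity : 0 ≤ c + 1 / c)]
  nlinarith [vh_le hc hu, norm_nonneg (Real.log u)]

lemma vh_one : ∫ u in Set.Ioi (0:ℝ), Real.log u * vh 1 u = 0 := by
  have h := integral_comp_rpow_Ioi (fun u => Real.log u * vh 1 u) (p := -1) (by norm_num)
  have h2 : ∫ u in Set.Ioi (0:ℝ), (|(-1:ℝ)| * u ^ ((-1:ℝ) - 1)) • (Real.log (u ^ (-1:ℝ)) * vh 1 (u ^ (-1:ℝ)))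
      = ∫ u in Set.Ioi (0:ℝ), -(Real.log u * vh 1 u) := by
    refine setIntegral_congr_fun measurableSet_Ioi fun u hu => ?_
    have hu0 : (0:ℝ) < u := hu
    have : u ^ ((-1:ℝ) - 1) = (u ^ 2)⁻¹ := by
      rw [show ((-1:ℝ) - 1) = -2 by norm_num, rpow_neg hu0.le, rpow_two]
    simp only [this, rpow_neg_one, Real.log_inv, vh, smul_eq_mul, abs_neg, abs_one]
    field_simp
    ring
  rw [h2, integral_neg] at h
  linarith

lemma vh_integral {c : ℝ} (hc : 0 < c) :
    ∫ u in Set.Ioi (0:ℝ), Real.log u * vh c u = π / 2 * Real.log c := by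
  have h := integral_comp_mul_left_Ioi (fun u => Real.log u * vh c u) 0 hc
  rw [mul_zero] at h
  have h2 : ∫ u in Set.Ioi (0:ℝ), Real.log (c * u) * vh c (c * u) =
      ∫ u in Set.Ioi (0:ℝ), c⁻¹ * (Real.log c * (1 + u ^ 2)⁻¹ + Real.log u * vh 1 u) := by
    refine setIntegral_congr_fun measurableSet_Ioi fun u hu => ?_
    have hu0 : (0:ℝ) < u := hu
    simp only [Real.log_mul hc.ne' hu0.ne', vh]
    field_simp
  rw [h2, integral_const_mul, integral_add (integrable_inv_one_add_sq.integrableOn.const_mul _) (vh_int one_pos),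
    vh_one, integral_const_mul, integral_Ioi_inv_one_add_sq, smul_eq_mul] at h
  have := mul_left_cancel₀ (inv_ne_zero hc.ne') h
  rw [← this]; simp; ring

lemma vh_re (c u : ℝ) : vh c u = (1 / ((c:ℂ) + u * Complex.I)).re := by
  simp [vh, Complex.normSq_apply, pow_two]

lemma vh_second {a u : ℝ} (ha : 1 ≤ a) (hu : 0 < u) :
    |vh a u - 2 * vh (a + π) u + vh (a + 2 * π) u| ≤ 2 * π ^ 2 * (a ^ (-(3/2):ℝ) * vD u) := by
  set z : ℂ := (a:ℂ) + u * Complex.I with hz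
  have hp := Real.pi_pos
  have key : ∀ b : ℝ, 0 ≤ b → √(a ^ 2 + u ^ 2) ≤ ‖z + b‖ := by
    intro b hb
    rw [Complex.norm_def]
    apply Real.sqrt_le_sqrt
    simp [hz, Complex.normSq_apply]
    nlinarith
  have hs : 0 < √(a ^ 2 + u ^ 2) := by positivity
  have k0 := key 0 le_rfl
  have k1 := key π hp.le
  have k2 := key (2 * π) (by positivity)
  push_cast at k0 k1 k2
  rw [add_zero] at k0
  have n0 : z ≠ 0 := norm_pos_iff.1 (hs.trans_le k0)
  have n1 : z + π ≠ 0 := norm_pos_iff.1 (hs.trans_le k1)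
  have n2 : z + 2 * π ≠ 0 := norm_pos_iff.1 (hs.trans_le k2)
  have e : vh a u - 2 * vh (a + π) u + vh (a + 2 * π) u
      = (2 * π ^ 2 / (z * (z + π) * (z + 2 * π)) : ℂ).re := by
    have : (2 * π ^ 2 / (z * (z + π) * (z + 2 * π)) : ℂ) =
       1 / z - ((2:ℝ):ℂ) * (1 / (z + π)) + 1 / (z + 2 * π) := by
      push_cast
      field_simp
      ring
    rw [this, Complex.add_re, Complex.sub_re, Complex.re_ofReal_mul, vh_re, vh_re, vh_re]
    push_cast
    simp only [hz, add_right_comm]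
  rw [e]
  refine (Complex.abs_re_le_norm _).trans ?_
  rw [norm_div, norm_mul, norm_mul, norm_mul, norm_pow, Complex.norm_real, Complex.norm_ofNat, Real.norm_of_nonneg hp.le,
    div_eq_mul_inv]
  gcongr
  have b1 : √(a ^ 2 + u ^ 2) ^ 3 ≤ ‖z‖ * ‖z + π‖ * ‖z + 2 * π‖ := by
    rw [pow_succ, pow_two]; gcongr
  have b2 : √(a ^ 2 + u ^ 2) ^ 3 = (a ^ 2 + u ^ 2) ^ (3/2:ℝ) := by
    rw [Real.sqrt_eq_rpow, ← rpow_natCast, ← rpow_mul (by positivity)]; norm_num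
  have b3 : (‖z‖ * ‖z + π‖ * ‖z + 2 * π‖)⁻¹ ≤ (a ^ 2 + u ^ 2) ^ (-(3/2):ℝ) := by
    rw [rpow_neg (by positivity), ← b2]; gcongr
  refine b3.trans ?_
  have ha0 : 0 < a := by linarith
  unfold vD
  rw [mul_min_of_nonneg _ _ (by positivity), mul_one, ← mul_rpow ha0.le hu.le]
  refine le_min ?_ ?_
  · exact rpow_le_rpow_of_nonpos ha0 (by nlinarith) (by norm_num)
  · exact rpow_le_rpow_of_nonpos (by positivity) (by nlinarith [sq_nonneg (a-u)]) (by norm_num)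
open Filter Topology

noncomputable def va (n : ℕ) : ℝ := π / 2 + 2 * π * n

noncomputable def vT (N : ℕ) (u : ℝ) : ℝ :=
  1 / 2 * vh (π / 2) u + ∑ n ∈ Finset.range N,
    1 / 2 * (vh (va n) u - 2 * vh (va n + π) u + vh (va n + 2 * π) u)

lemma va_succ (n : ℕ) : va (n + 1) = va n + 2 * π := by unfold va; push_cast; ring

lemma va_pos (n : ℕ) : 0 < va n := by unfold va; positivity

lemma vT_eq (N : ℕ) (u : ℝ) : vT N u = vh (π / 2) u + (∑ n ∈ Finset.range N,
    (vh (va n + 2 * π) u - vh (va n + π) u)) - 1 / 2 * vh (va N) u := by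
  induction N with
  | zero => simp [vT, va]; ring
  | succ N ih =>
    have : vT (N + 1) u = vT N u + 1 / 2 * (vh (va N) u - 2 * vh (va N + π) u + vh (va N + 2 * π) u) := by
      simp only [vT, Finset.sum_range_succ]; ring
    rw [this, ih, Finset.sum_range_succ, va_succ]; ring

noncomputable def vw (u : ℝ) : ℂ := 1 / 4 + (u / (2 * π) : ℝ) * Complex.I

lemma vw_re (b u : ℝ) : (1 / (vw u + b)).re = 2 * π * vh (π / 2 + 2 * π * b) u := by
  have hp := Real.pi_pos
  have e : vw u + b = ((1 / (2 * π) : ℝ) : ℂ) * (((π / 2 + 2 * π * b : ℝ) : ℂ) + u * Complex.I) := by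
    have : (π : ℂ) ≠ 0 := by exact_mod_cast hp.ne'
    unfold vw
    push_cast
    field_simp
    ring
  have e2 : 1 / (vw u + b) = ((2 * π : ℝ) : ℂ) * (1 / (((π / 2 + 2 * π * b : ℝ) : ℂ) + u * Complex.I)) := by
    rw [e, one_div, mul_inv, ← Complex.ofReal_inv]; simp
  rw [e2, Complex.re_ofReal_mul, ← vh_re]

lemma vw_mem (u : ℝ) : vw u ∈ Complex.integerComplement := by
  rintro ⟨n, hn⟩
  have := congrArg Complex.re hn
  simp [vw, -Complex.ofReal_div] at this
  have h4 : (4 * n : ℝ) = 1 := by rw [this]; norm_num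
  have : 4 * n = 1 := by exact_mod_cast h4
  omega

noncomputable def vK (u : ℝ) : ℝ := Real.exp u / (1 + Real.exp u ^ 2)

lemma vw_cot (u : ℝ) : (π * Complex.cot (π * vw u)).re = 2 * π * vK u := by
  have hpc : (π : ℂ) ≠ 0 := by exact_mod_cast Real.pi_pos.ne'
  have hE : Complex.exp (2 * π * Complex.I * vw u) = Complex.I * ((Real.exp (-u) : ℝ) : ℂ) := by
    have : 2 * π * Complex.I * vw u = (π / 2 * Complex.I) + ((-u : ℝ) : ℂ) := by
      unfold vw
      push_cast
      field_simp
      linear_combination (8 * (u:ℂ)) * Complex.I_sq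
    rw [this, Complex.exp_add, Complex.exp_pi_div_two_mul_I, Complex.ofReal_exp]
  rw [Complex.re_ofReal_mul, Complex.cot_pi_eq_exp_ratio, hE]
  set q := Real.exp (-u) with hq
  have hq0 : 0 < q := Real.exp_pos _
  have hK : vK u = q / (1 + q ^ 2) := by
    have : Real.exp u = q⁻¹ := by rw [hq, Real.exp_neg, inv_inv]
    unfold vK
    rw [this]; field_simp; ring
  have : (Complex.I * (1 - Complex.I * (q:ℂ))) = (q : ℂ) + Complex.I := by
    linear_combination -(q:ℂ) * Complex.I_sq
  rw [this, hK, Complex.div_re]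
  simp [Complex.normSq_apply]
  field_simp
  ring

lemma vh_va_tendsto (u : ℝ) : Tendsto (fun N => vh (va N) u) atTop (𝓝 0) := by
  have h1 : Tendsto va atTop atTop := by
    unfold va
    exact tendsto_atTop_add_const_left _ _ (tendsto_natCast_atTop_atTop.const_mul_atTop (by positivity))
  refine squeeze_zero (fun N => vh_nonneg (va_pos N) u) (fun N => ?_) h1.inv_tendsto_atTop
  have := va_pos N
  simp only [Pi.inv_apply]
  rw [← one_div, vh, div_le_div_iff₀ (by positivity) this]; nlinarith [sq_nonneg u]

lemma vT_tendsto (u : ℝ) : Tendsto (fun N => vT N u) atTop (𝓝 (vK u)) := by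
  have hp := Real.pi_pos
  have h := tendsto_logDeriv_euler_cot_sub (vw_mem u)
  have h2 := (Complex.continuous_re.tendsto _).comp h
  have h0 : (1 / vw u).re = 2 * π * vh (π / 2) u := by simpa using vw_re 0 u
  rw [Complex.sub_re, vw_cot, h0] at h2
  have h3 : ∀ N : ℕ, (∑ j ∈ Finset.range N, cotTerm (vw u) j).re
     = 2 * π * ∑ n ∈ Finset.range N, (vh (va n + 2 * π) u - vh (va n + π) u) := by
    intro N
    rw [Complex.re_sum, Finset.mul_sum]
    refine Finset.sum_congr rfl fun n _ => ?_
    have e1 := vw_re (n + 1) u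
    have e2 := vw_re (-(n + 1)) u
    push_cast at e1 e2
    rw [cotTerm, Complex.add_re, e1, sub_eq_add_neg, e2]
    have : vh (π / 2 + 2 * π * -(n + 1)) u = - vh (va n + π) u := by
      rw [show π / 2 + 2 * π * -((n:ℝ) + 1) = -(va n + π) by unfold va; ring]
      simp only [vh, neg_sq, neg_div]
    rw [this, show π / 2 + 2 * π * ((n:ℝ) + 1) = va n + 2 * π by unfold va; ring]
    ring
  have h4 := ((h2.const_mul (1 / (2 * π))).const_add (vh (π / 2) u)).sub ((vh_va_tendsto u).const_mul (1/2))
  convert h4 using 1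
  · ext N
    simp only [Function.comp_apply, h3, vT_eq]
    field_simp
  · congr 1
    field_simp
    ring

lemma vT_bound : ∃ C : ℝ, ∀ N u, 0 < u → |vT N u| ≤ C * vD u := by
  have hs : Summable (fun n : ℕ => (va n) ^ (-(3/2):ℝ)) := by
    have := (Real.summable_nat_rpow (p := -(3/2))).2 (by norm_num)
    rw [← summable_nat_add_iff 1]
    refine Summable.of_nonneg_of_le (fun n => rpow_nonneg (va_pos _).le _) (fun n => ?_) ((summable_nat_add_iff 1).2 this)
    refine rpow_le_rpow_of_nonpos (by positivity) ?_ (by norm_num)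
    unfold va
    have : (0:ℝ) ≤ ((n + 1 : ℕ) : ℝ) := by positivity
    nlinarith [Real.pi_gt_three]
  refine ⟨1 / 2 * (π / 2 + 1 / (π / 2)) + π ^ 2 * ∑' n, (va n) ^ (-(3/2):ℝ), fun N u hu => ?_⟩
  have hD := vD_pos hu
  unfold vT
  refine (abs_add_le _ _).trans ?_
  rw [add_mul]
  refine add_le_add ?_ ?_
  · rw [abs_of_nonneg (mul_nonneg (by norm_num) (vh_nonneg (by positivity) u)), mul_assoc]
    exact mul_le_mul_of_nonneg_left (vh_le (by positivity) hu) (by norm_num)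
  · refine (Finset.abs_sum_le_sum_abs _ _).trans ?_
    have h1 : ∀ n ∈ Finset.range N, |1 / 2 * (vh (va n) u - 2 * vh (va n + π) u + vh (va n + 2 * π) u)|
        ≤ π ^ 2 * vD u * (va n) ^ (-(3/2):ℝ) := by
      intro n _
      have ha : 1 ≤ va n := by
        unfold va
        have : (0:ℝ) ≤ 2 * π * n := by positivity
        linarith [Real.pi_gt_three]
      have := vh_second ha hu
      rw [abs_mul, abs_of_pos (by norm_num : (0:ℝ) < 1/2)]
      linarith
    refine (Finset.sum_le_sum h1).trans ?_
    rw [← Finset.mul_sum]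
    have := hs.sum_le_tsum (Finset.range N) (fun n _ => rpow_nonneg (va_pos n).le _)
    calc _ ≤ π ^ 2 * vD u * ∑' n, (va n) ^ (-(3/2):ℝ) := by gcongr
      _ = _ := by ring

lemma vT_integral (N : ℕ) : ∫ u in Set.Ioi (0:ℝ), Real.log u * vT N u =
    π / 2 * (Real.log (π / 2) + (∑ n ∈ Finset.range N,
    (Real.log (va n + 2 * π) - Real.log (va n + π))) - 1 / 2 * Real.log (va N)) := by
  have e : ∀ u, Real.log u * vT N u = (Real.log u * vh (π / 2) u + ∑ n ∈ Finset.range N,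
    (Real.log u * vh (va n + 2 * π) u - Real.log u * vh (va n + π) u)) - 1 / 2 * (Real.log u * vh (va N) u) := by
    intro u
    rw [vT_eq, mul_sub, mul_add, Finset.mul_sum]
    simp only [mul_sub]
    ring
  have hp := Real.pi_pos
  have p1 : ∀ n, 0 < va n + 2 * π := fun n => by have := va_pos n; positivity
  have p2 : ∀ n, 0 < va n + π := fun n => by have := va_pos n; positivity
  have is : ∀ n ∈ Finset.range N, Integrable (fun u => Real.log u * vh (va n + 2 * π) u - Real.log u * vh (va n + π) u)
      (volume.restrict (Set.Ioi 0)) := fun n _ => (vh_int (p1 n)).sub (vh_int (p2 n))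
  have i0 : IntegrableOn (fun u => Real.log u * vh (π / 2) u) (Set.Ioi 0) := vh_int (by positivity)
  have i1 : IntegrableOn (fun u => Real.log u * vh (π / 2) u + ∑ n ∈ Finset.range N,
    (Real.log u * vh (va n + 2 * π) u - Real.log u * vh (va n + π) u)) (Set.Ioi 0) :=
    i0.add (integrable_finsetSum _ is)
  simp only [e]
  rw [integral_sub i1 ((vh_int (va_pos N)).const_mul _),
    integral_add i0 (integrable_finsetSum _ is), integral_finsetSum _ is, integral_const_mul,
    vh_integral (va_pos N), vh_integral (by positivity)]
  have : ∀ n ∈ Finset.range N, (∫ u in Set.Ioi (0:ℝ), (Real.log u * vh (va n + 2 * π) u - Real.log u * vh (va n + π) u))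
     = π / 2 * (Real.log (va n + 2 * π) - Real.log (va n + π)) := by
    intro n _
    rw [integral_sub (vh_int (p1 n)) (vh_int (p2 n)), vh_integral (p1 n), vh_integral (p2 n)]; ring
  rw [Finset.sum_congr rfl this, ← Finset.mul_sum]
  ring

lemma vT_lim : Tendsto (fun N => ∫ u in Set.Ioi (0:ℝ), Real.log u * vT N u) atTop
    (𝓝 (∫ u in Set.Ioi (0:ℝ), Real.log u * vK u)) := by
  obtain ⟨C, hC⟩ := vT_bound
  refine tendsto_integral_of_dominated_convergence (fun u => ‖C * (Real.log u * vD u)‖) (fun N => ?_)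
    (vD_int.const_mul C).norm (fun N => ?_) ?_
  · refine Measurable.aestronglyMeasurable ?_
    unfold vT vh
    fun_prop
  · filter_upwards [ae_restrict_mem measurableSet_Ioi] with u hu
    have := (hC N u hu).trans (le_abs_self _)
    rw [show C * (Real.log u * vD u) = Real.log u * (C * vD u) by ring, norm_mul, norm_mul]
    exact mul_le_mul_of_nonneg_left this (norm_nonneg _)
  · exact Eventually.of_forall fun u => (vT_tendsto u).const_mul _

lemma vlog_sum (N : ℕ) : Real.log (π / 2) + (∑ n ∈ Finset.range N,
    (Real.log (va n + 2 * π) - Real.log (va n + π))) = 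
    (∑ m ∈ Finset.range (N + 1), Real.log (1 / 4 + m)) - (∑ m ∈ Finset.range (N + 1), Real.log (3 / 4 + m))
      + Real.log (va N + π) := by
  have hp := Real.pi_pos
  have l1 : ∀ n : ℕ, Real.log (va n) = Real.log (2 * π) + Real.log (1 / 4 + n) := fun n => by
    rw [← Real.log_mul (by positivity) (by positivity)]; congr 1; unfold va; ring
  have l2 : ∀ n : ℕ, Real.log (va n + π) = Real.log (2 * π) + Real.log (3 / 4 + n) := fun n => by
    rw [← Real.log_mul (by positivity) (by positivity)]; congr 1; unfold va; ring
  induction N with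
  | zero =>
    have := l1 0
    have h2 := l2 0
    simp [va] at this h2 ⊢
    rw [this, h2]; ring
  | succ N ih =>
    rw [Finset.sum_range_succ, ← add_assoc, ih, Finset.sum_range_succ _ (N + 1), Finset.sum_range_succ _ (N + 1),
      ← va_succ, l1 (N + 1), l2 (N + 1)]
    ring

lemma vlog_lim : Tendsto (fun N => Real.log (π / 2) + (∑ n ∈ Finset.range N,
    (Real.log (va n + 2 * π) - Real.log (va n + π))) - 1 / 2 * Real.log (va N)) atTop
    (𝓝 (Real.log (Real.sqrt (2 * π) * Real.Gamma (3/4) / Real.Gamma (1/4)))) := by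
  have hp := Real.pi_pos
  have g1 := Real.BohrMollerup.tendsto_log_gamma (x := 1/4) (by norm_num)
  have g3 := Real.BohrMollerup.tendsto_log_gamma (x := 3/4) (by norm_num)
  have r : Tendsto (fun N : ℕ => va N / N) atTop (𝓝 (2 * π)) := by
    have := ((tendsto_const_div_atTop_nhds_zero_nat (π / 2)).add_const (2 * π))
    rw [zero_add] at this
    refine this.congr' ?_
    filter_upwards [eventually_gt_atTop 0] with N hN
    have : (0:ℝ) < N := by exact_mod_cast hN
    unfold va; field_simp
  have r2 : Tendsto (fun N : ℕ => (va N + π) / N) atTop (𝓝 (2 * π)) := by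
    have := r.add (tendsto_const_div_atTop_nhds_zero_nat π)
    rw [add_zero] at this
    refine this.congr fun N => ?_
    rw [add_div]
  have s := (r2.log (by positivity)).sub ((r.log (by positivity)).const_mul (1/2))
  have tot := (g3.sub g1).add s
  have e : Real.log (Real.sqrt (2 * π) * Real.Gamma (3/4) / Real.Gamma (1/4)) =
     Real.log (Real.Gamma (3/4)) - Real.log (Real.Gamma (1/4)) + (Real.log (2 * π) - 1 / 2 * Real.log (2 * π)) := by
    have q1 : 0 < Real.Gamma (1/4) := Real.Gamma_pos_of_pos (by norm_num)
    have q3 : 0 < Real.Gamma (3/4) := Real.Gamma_pos_of_pos (by norm_num)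
    rw [Real.log_div (by positivity) q1.ne', Real.log_mul (by positivity) q3.ne', Real.log_sqrt (by positivity)]
    ring
  rw [e]
  refine tot.congr' ?_
  filter_upwards [eventually_gt_atTop 0] with N hN
  have hN' : (0:ℝ) < N := by exact_mod_cast hN
  have := va_pos N
  rw [vlog_sum, Real.log_div (by positivity) hN'.ne', Real.log_div (by positivity) hN'.ne']
  simp only [Real.BohrMollerup.logGammaSeq]
  ring

lemma vK_integral : ∫ u in Set.Ioi (0:ℝ), Real.log u * vK u =
    (π / 2) * Real.log (Real.sqrt (2 * π) * Real.Gamma (3/4) / Real.Gamma (1/4)) := by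
  refine tendsto_nhds_unique vT_lim ?_
  simp only [vT_integral]
  exact vlog_lim.const_mul _

lemma v_image : (fun u => Real.arctan (Real.exp u)) '' Set.Ioi 0 = Set.Ioo (π / 4) (π / 2) := by
  ext t
  constructor
  · rintro ⟨u, hu, rfl⟩
    refine ⟨?_, Real.arctan_lt_pi_div_two _⟩
    rw [← Real.arctan_one]
    exact Real.arctan_strictMono (Real.one_lt_exp_iff.2 hu)
  · rintro ⟨h1, h2⟩
    have hp := Real.pi_pos
    have ht : 1 < Real.tan t := by
      rw [← Real.tan_pi_div_four]
      exact Real.tan_lt_tan_of_lt_of_lt_pi_div_two (by linarith) h2 h1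
    refine ⟨Real.log (Real.tan t), Real.log_pos ht, ?_⟩
    simp only
    rw [Real.exp_log (by linarith), Real.arctan_tan (by linarith) h2]

theorem stmt5 :
    ∫ t in (π/4)..(π/2), Real.log (Real.log (Real.tan t)) =
      (π / 2) * Real.log (Real.sqrt (2 * π) * Real.Gamma (3/4) / Real.Gamma (1/4)) := by
  rw [intervalIntegral.integral_of_le (by linarith [Real.pi_pos]), integral_Ioc_eq_integral_Ioo, ← v_image,
    integral_image_eq_integral_abs_deriv_smul (f' := vK) measurableSet_Ioi
      (fun u _ => ?_) (fun x _ y _ h => Real.exp_injective (Real.arctan_injective h)),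
    ← vK_integral]
  · refine setIntegral_congr_fun measurableSet_Ioi fun u _ => ?_
    have : 0 < vK u := by unfold vK; positivity
    simp only [Real.tan_arctan, Real.log_exp, smul_eq_mul, abs_of_pos this]
    ring
  · refine HasDerivAt.hasDerivWithinAt ?_
    have h := (Real.hasDerivAt_exp u).arctan
    have e : vK u = 1 / (1 + Real.exp u ^ 2) * Real.exp u := by unfold vK; ring
    rw [e]; exact h
end

section
/- For 0 < v < 1 and b > 0, the principal value integral satisfies PV ∫₀^∞ x^{v−1}/(x−b) dx = −π b^{v−1} cot(π v). -/
open MeasureTheory Real Filter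

lemma aux_hasSum (v : ℝ) (hv0 : 0 < v) (hv1 : v < 1) :
    HasSum (fun n : ℕ => 1 / ((n:ℝ) + 1 - v) - 1 / ((n:ℝ) + v))
      (-π * (Real.cos (π * v) / Real.sin (π * v))) := by
  have hz : (v : ℂ) ∈ Complex.integerComplement := by
    rw [Complex.mem_integerComplement_iff]
    rintro ⟨n, hn⟩
    have h : (n : ℝ) = v := by exact_mod_cast hn
    have h1 : (0:ℝ) < n := by linarith
    have h2 : (n:ℝ) < 1 := by linarith
    have h3 : 0 < n := by exact_mod_cast h1
    have h4 : n < 1 := by exact_mod_cast h2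
    omega
  have h1 := (summable_cotTerm hz).hasSum
  have h2 := cot_series_rep' hz
  have h3 : HasSum (fun n : ℕ => 1 / (v - ((n:ℝ) + 1)) + 1 / (v + ((n:ℝ) + 1)))
      (π * (Real.cos (π * v) / Real.sin (π * v)) - 1 / v) := by
    rw [← Complex.hasSum_ofReal]
    push_cast
    rw [← Complex.cot_eq_cos_div_sin, h2]
    exact h1
  have h4 : HasSum (fun n : ℕ => 1 / ((n:ℝ) + v) - 1 / (((n+1:ℕ):ℝ) + v)) (1 / v) := by
    rw [hasSum_iff_tendsto_nat_of_nonneg]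
    · simp_rw [Finset.sum_range_sub' (fun n : ℕ => 1 / ((n:ℝ) + v))]
      have : Tendsto (fun n : ℕ => 1 / ((n:ℝ) + v)) atTop (nhds 0) := by
        simp_rw [one_div]
        exact (tendsto_atTop_add_const_right _ _ tendsto_natCast_atTop_atTop).inv_tendsto_atTop
      simpa using this.const_sub (1 / v)
    · intro n
      rw [sub_nonneg]
      apply one_div_le_one_div_of_le
      · positivity
      · push_cast; linarith
  have h5 := (h3.neg).sub h4
  convert! h5 using 1
  · ext n
    have : (n:ℝ) + 1 - v ≠ 0 := by
      have : (0:ℝ) ≤ n := by positivity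
      linarith
    have e : 1 / (v - ((n:ℝ) + 1)) = - (1 / ((n:ℝ) + 1 - v)) := by
      rw [← neg_sub, one_div, one_div, inv_neg]
    rw [e]
    push_cast
    ring_nf
  · ring

lemma aux_rpow_int (r : ℝ) (hr : -1 < r) : IntegrableOn (fun y : ℝ => y ^ r) (Set.Ioo 0 1) := by
  rw [intervalIntegral.integrableOn_Ioo_rpow_iff one_pos]; exact hr

lemma aux_rpow_integral (r : ℝ) (hr : -1 < r) : ∫ y in Set.Ioo (0:ℝ) 1, y ^ r = 1 / (r + 1) := by
  rw [← integral_Ioc_eq_integral_Ioo, ← intervalIntegral.integral_of_le zero_le_one,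
    integral_rpow (Or.inl hr)]
  rw [Real.zero_rpow (by linarith), Real.one_rpow, sub_zero]

lemma aux_f_int (v : ℝ) (hv0 : 0 < v) (hv1 : v < 1) :
    IntegrableOn (fun y : ℝ => (y ^ (-v) - y ^ (v - 1)) / (1 - y)) (Set.Ioo 0 1) := by
  refine Integrable.mono' ((aux_rpow_int (-v) (by linarith)).add
    (aux_rpow_int (v-1) (by linarith))) ?_ ?_
  · exact Measurable.aestronglyMeasurable (by fun_prop)
  · filter_upwards [ae_restrict_mem measurableSet_Ioo] with y hy
    obtain ⟨h0, h1⟩ := hy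
    have hd : 0 < 1 - y := by linarith
    have ha := Real.rpow_pos_of_pos h0 (-v)
    have hb := Real.rpow_pos_of_pos h0 (v-1)
    rw [norm_div, Real.norm_of_nonneg hd.le, div_le_iff₀ hd, Real.norm_eq_abs, abs_le]
    have e1 : y ^ (-v) * y ≤ y ^ (v-1) := by
      rw [← Real.rpow_add_one h0.ne']
      exact Real.rpow_le_rpow_of_exponent_ge h0 h1.le (by linarith)
    have e2 : y ^ (v-1) * y ≤ y ^ (-v) := by
      rw [← Real.rpow_add_one h0.ne']
      exact Real.rpow_le_rpow_of_exponent_ge h0 h1.le (by linarith)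
    simp only [Pi.add_apply]
    constructor <;> nlinarith

lemma aux_f_integral (v : ℝ) (hv0 : 0 < v) (hv1 : v < 1) :
    ∫ y in Set.Ioo (0:ℝ) 1, (y ^ (-v) - y ^ (v - 1)) / (1 - y) =
      -π * (Real.cos (π * v) / Real.sin (π * v)) := by
  have hs := aux_hasSum v hv0 hv1
  set F : ℕ → ℝ → ℝ := fun n y => y ^ ((n:ℝ) - v) - y ^ ((n:ℝ) + v - 1) with hF
  have hp : ∀ n : ℕ, (0:ℝ) ≤ n := fun n => by positivity
  have hi1 : ∀ n : ℕ, IntegrableOn (fun y : ℝ => y ^ ((n:ℝ) - v)) (Set.Ioo 0 1) := fun n =>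
    aux_rpow_int _ (by linarith [hp n])
  have hi2 : ∀ n : ℕ, IntegrableOn (fun y : ℝ => y ^ ((n:ℝ) + v - 1)) (Set.Ioo 0 1) := fun n =>
    aux_rpow_int _ (by linarith [hp n])
  have hI : ∀ n, ∫ y in Set.Ioo (0:ℝ) 1, F n y = 1 / ((n:ℝ) + 1 - v) - 1 / ((n:ℝ) + v) := by
    intro n
    rw [hF, integral_sub (hi1 n) (hi2 n), aux_rpow_integral _ (by linarith [hp n]),
      aux_rpow_integral _ (by linarith [hp n])]
    ring_nf
  have hN : ∀ n, ∫ y in Set.Ioo (0:ℝ) 1, ‖F n y‖ = |1 / ((n:ℝ) + 1 - v) - 1 / ((n:ℝ) + v)| := by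
    intro n
    rw [← hI]
    rcases le_total (1/2) v with h | h
    · have : ∀ y ∈ Set.Ioo (0:ℝ) 1, 0 ≤ F n y := fun y hy => by
        simp only [hF, sub_nonneg]
        exact Real.rpow_le_rpow_of_exponent_ge hy.1 hy.2.le (by linarith)
      rw [abs_of_nonneg (setIntegral_nonneg measurableSet_Ioo this)]
      exact setIntegral_congr_fun measurableSet_Ioo fun y hy => Real.norm_of_nonneg (this y hy)
    · have : ∀ y ∈ Set.Ioo (0:ℝ) 1, F n y ≤ 0 := fun y hy => by
        simp only [hF, sub_nonpos]
        exact Real.rpow_le_rpow_of_exponent_ge hy.1 hy.2.le (by linarith)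
      rw [abs_of_nonpos (setIntegral_nonpos measurableSet_Ioo this), ← integral_neg]
      exact setIntegral_congr_fun measurableSet_Ioo fun y hy => Real.norm_of_nonpos (this y hy)
  have key := hasSum_integral_of_summable_integral_norm (μ := volume.restrict (Set.Ioo (0:ℝ) 1))
    (F := F) (fun n => (hi1 n).sub (hi2 n)) (by simp_rw [hN]; exact hs.summable.abs)
  simp_rw [hI] at key
  rw [hs.unique key]
  refine setIntegral_congr_fun measurableSet_Ioo fun y hy => ?_
  have hg := (hasSum_geometric_of_lt_one hy.1.le hy.2).mul_left (y ^ (-v) - y ^ (v - 1))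
  have : (fun n => F n y) = fun n : ℕ => (y ^ (-v) - y ^ (v - 1)) * y ^ n := by
    ext n
    rw [← Real.rpow_natCast, sub_mul, ← Real.rpow_add hy.1, ← Real.rpow_add hy.1]
    simp only [hF]; ring_nf
  simp only [this, hg.tsum_eq]
  rw [div_eq_mul_inv]

lemma aux_first (v b ε : ℝ) (hb : 0 < b) :
    ∫ x in Set.Ioo (0:ℝ) (b - ε), x ^ (v - 1) / (x - b) =
      b ^ (v-1) * (- ∫ y in Set.Ioo (0:ℝ) (1 - ε / b), y ^ (v-1) / (1 - y)) := by
  have him : (fun y : ℝ => b * y) '' Set.Ioo (0:ℝ) (1 - ε / b) = Set.Ioo (0:ℝ) (b - ε) := by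
    rw [Set.image_mul_left_Ioo hb]
    congr 1
    · simp
    · field_simp
  rw [← him, integral_image_eq_integral_abs_deriv_smul (f' := fun _ => b) measurableSet_Ioo
    (fun x _ => by simpa using ((hasDerivAt_id x).const_mul b).hasDerivWithinAt)
    (fun x _ y _ h => mul_left_cancel₀ hb.ne' h), ← integral_neg, ← integral_const_mul]
  refine setIntegral_congr_fun measurableSet_Ioo fun y hy => ?_
  simp only [smul_eq_mul]
  rw [abs_of_pos hb, Real.mul_rpow hb.le hy.1.le, show b * y - b = - (b * (1 - y)) by ring, div_neg,
    mul_div_mul_comm]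
  field_simp

lemma aux_second (v b ε : ℝ) (hb : 0 < b) (hε : 0 < ε) :
    ∫ x in Set.Ioi (b + ε), x ^ (v - 1) / (x - b) =
      b ^ (v-1) * (∫ y in Set.Ioo (0:ℝ) (1 / (1 + ε / b)), y ^ (-v) / (1 - y)) := by
  have hr : 1 / (1 + ε / b) = b / (b + ε) := by field_simp
  rw [hr]
  have him : (fun y : ℝ => b * y⁻¹) '' Set.Ioo (0:ℝ) (b / (b + ε)) = Set.Ioi (b + ε) := by
    ext x
    simp only [Set.mem_image, Set.mem_Ioo, Set.mem_Ioi]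
    constructor
    · rintro ⟨y, ⟨h0, h1⟩, rfl⟩
      rw [lt_div_iff₀ (by positivity)] at h1
      rw [← div_eq_mul_inv, lt_div_iff₀ h0]
      linarith
    · intro h
      have hx : 0 < x := by linarith
      refine ⟨b / x, ⟨by positivity, ?_⟩, by field_simp⟩
      exact div_lt_div_of_pos_left hb (by positivity) h
  rw [← him, integral_image_eq_integral_abs_deriv_smul (f' := fun y => b * (-(y^2)⁻¹))
    measurableSet_Ioo
    (fun x hx => ((hasDerivAt_inv hx.1.ne').const_mul b).hasDerivWithinAt)
    (fun x _ y _ h => inv_injective (mul_left_cancel₀ hb.ne' h)), ← integral_const_mul]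
  refine setIntegral_congr_fun measurableSet_Ioo fun y hy => ?_
  have hy0 := hy.1
  have hy1 : y < 1 := hy.2.trans (by rw [div_lt_one (by positivity)]; linarith)
  have hd : 1 - y ≠ 0 := by linarith
  simp only [smul_eq_mul]
  rw [mul_neg, abs_neg, abs_of_pos (by positivity), Real.mul_rpow hb.le (by positivity),
    Real.inv_rpow hy0.le, show b * y⁻¹ - b = b * (1 - y) / y by field_simp, Real.rpow_neg hy0.le,
    Real.rpow_sub_one hy0.ne' v]
  field_simp

lemma aux_int_c (r c : ℝ) (hr : -1 < r) (hc : c < 1) :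
    IntegrableOn (fun y : ℝ => y ^ r / (1 - y)) (Set.Ioo 0 c) := by
  refine Integrable.mono' (((aux_rpow_int r hr).mono_set
    (Set.Ioo_subset_Ioo_right hc.le)).div_const (1 - c)) ?_ ?_
  · exact Measurable.aestronglyMeasurable (by fun_prop)
  · filter_upwards [ae_restrict_mem measurableSet_Ioo] with y hy
    obtain ⟨h0, h1⟩ := hy
    have hd : 0 < 1 - y := by linarith
    have ha := Real.rpow_pos_of_pos h0 r
    rw [Real.norm_of_nonneg (by positivity)]
    exact div_le_div_of_nonneg_left ha.le (by linarith) (by linarith)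

lemma aux_split (v δ : ℝ) (hv0 : 0 < v) (hv1 : v < 1) (hδ : 0 < δ) (hδ1 : δ < 1/2) :
    (- ∫ y in Set.Ioo (0:ℝ) (1 - δ), y ^ (v-1) / (1 - y)) +
      (∫ y in Set.Ioo (0:ℝ) (1 / (1 + δ)), y ^ (-v) / (1 - y)) =
    (∫ y in (0:ℝ)..(1 - δ), (y ^ (-v) - y ^ (v - 1)) / (1 - y)) +
      ∫ y in Set.Ico (1 - δ) (1 / (1 + δ)), y ^ (-v) / (1 - y) := by
  have hcr : 1 - δ ≤ 1 / (1 + δ) := by rw [le_div_iff₀ (by positivity)]; nlinarith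
  have hr1 : 1 / (1 + δ) < 1 := by rw [div_lt_one (by positivity)]; linarith
  have hint := aux_int_c (-v) _ (by linarith) hr1
  rw [intervalIntegral.integral_of_le (by linarith), integral_Ioc_eq_integral_Ioo]
  simp_rw [sub_div]
  rw [integral_sub (aux_int_c (-v) _ (by linarith) (by linarith))
    (aux_int_c (v-1) _ (by linarith) (by linarith))]
  rw [← Set.Ioo_union_Ico_eq_Ioo (show (0:ℝ) < 1 - δ by linarith) hcr, setIntegral_union _
    measurableSet_Ico]
  · ring
  · exact hint.mono_set (Set.Ioo_subset_Ioo_right hcr)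
  · exact hint.mono_set fun y hy => ⟨by linarith [hy.1], hy.2⟩
  · rw [Set.disjoint_left]
    intro y hy hy'
    exact absurd hy.2 (not_lt.mpr hy'.1)

lemma aux_err (v δ : ℝ) (hv0 : 0 < v) (hv1 : v < 1) (hδ : 0 < δ) (hδ1 : δ < 1/2) :
    ‖∫ y in Set.Ico (1 - δ) (1 / (1 + δ)), y ^ (-v) / (1 - y)‖ ≤ 2 * δ := by
  have hcr : 1 - δ ≤ 1 / (1 + δ) := by rw [le_div_iff₀ (by positivity)]; nlinarith
  have h := norm_setIntegral_le_of_norm_le_const (μ := volume) (s := Set.Ico (1 - δ) (1 / (1 + δ)))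
    (f := fun y : ℝ => y ^ (-v) / (1 - y)) (C := 2 * (1 + δ) / δ) (by simp) ?_
  · refine h.trans (le_of_eq ?_)
    rw [Real.volume_real_Ico_of_le hcr]
    field_simp
    ring
  · intro y hy
    have h0 : 1/2 < y := by linarith [hy.1]
    have hy0 : 0 < y := by linarith
    have h1 : δ / (1 + δ) ≤ 1 - y := by
      have : δ / (1 + δ) = 1 - 1 / (1 + δ) := by field_simp; ring
      linarith [hy.2]
    have h2 : 0 < δ / (1 + δ) := by positivity
    have h3 : y ^ (-v) ≤ 2 := by
      have : y ^ (-v) ≤ y ^ (-1:ℝ) := Real.rpow_le_rpow_of_exponent_ge hy0 (by linarith) (by linarith)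
      rw [Real.rpow_neg_one] at this
      refine this.trans ?_
      rw [inv_le_comm₀ hy0 two_pos]
      linarith
    have hp := Real.rpow_pos_of_pos hy0 (-v)
    rw [Real.norm_of_nonneg (div_nonneg hp.le (by linarith))]
    calc y ^ (-v) / (1 - y) ≤ 2 / (δ / (1 + δ)) := div_le_div₀ two_pos.le h3 h2 h1
      _ = _ := by field_simp

lemma aux_main (v : ℝ) (hv0 : 0 < v) (hv1 : v < 1) :
    Tendsto (fun δ : ℝ => (- ∫ y in Set.Ioo (0:ℝ) (1 - δ), y ^ (v-1) / (1 - y)) +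
      (∫ y in Set.Ioo (0:ℝ) (1 / (1 + δ)), y ^ (-v) / (1 - y)))
      (nhdsWithin 0 (Set.Ioi 0)) (nhds (-π * (Real.cos (π * v) / Real.sin (π * v)))) := by
  have hsmall : ∀ᶠ δ : ℝ in nhdsWithin 0 (Set.Ioi 0), 0 < δ ∧ δ < 1/2 :=
    Ioo_mem_nhdsGT (by norm_num)
  have hA : Tendsto (fun δ : ℝ => ∫ y in (0:ℝ)..(1 - δ), (y ^ (-v) - y ^ (v - 1)) / (1 - y))
      (nhdsWithin 0 (Set.Ioi 0)) (nhds (-π * (Real.cos (π * v) / Real.sin (π * v)))) := by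
    have hc := intervalIntegral.continuousOn_primitive_interval (a := 0) (b := 1) (μ := volume)
      (f := fun y : ℝ => (y ^ (-v) - y ^ (v - 1)) / (1 - y))
      (by rw [Set.uIcc_of_le zero_le_one, integrableOn_Icc_iff_integrableOn_Ioo]
          exact aux_f_int v hv0 hv1)
    have h1 := hc 1 (by simp)
    rw [ContinuousWithinAt, intervalIntegral.integral_of_le zero_le_one,
      integral_Ioc_eq_integral_Ioo, aux_f_integral v hv0 hv1] at h1
    refine h1.comp (tendsto_nhdsWithin_iff.mpr ⟨?_, ?_⟩)
    · have : Tendsto (fun δ : ℝ => 1 - δ) (nhds 0) (nhds (1 - 0)) := by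
        exact (continuous_const.sub continuous_id).tendsto 0
      rw [sub_zero] at this
      exact this.mono_left nhdsWithin_le_nhds
    · filter_upwards [hsmall] with δ hδ
      rw [Set.uIcc_of_le zero_le_one]
      exact ⟨by linarith [hδ.2], by linarith [hδ.1]⟩
  have hB : Tendsto (fun δ : ℝ => ∫ y in Set.Ico (1 - δ) (1 / (1 + δ)), y ^ (-v) / (1 - y))
      (nhdsWithin 0 (Set.Ioi 0)) (nhds 0) := by
    refine squeeze_zero_norm' (a := fun δ => 2 * δ) ?_ ?_
    · filter_upwards [hsmall] with δ hδ using aux_err v δ hv0 hv1 hδ.1 hδ.2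
    · have : Tendsto (fun δ : ℝ => 2 * δ) (nhds 0) (nhds (2 * 0)) :=
        (continuous_const.mul continuous_id).tendsto 0
      rw [mul_zero] at this
      exact this.mono_left nhdsWithin_le_nhds
  have := hA.add hB
  rw [add_zero] at this
  refine this.congr' ?_
  filter_upwards [hsmall] with δ hδ using (aux_split v δ hv0 hv1 hδ.1 hδ.2).symm

/-- Cauchy principal value of `∫₀^∞ x^{v−1}/(x−b) dx` at the simple pole `x = b`. -/
theorem stmt17 (v b : ℝ) (hv0 : 0 < v) (hv1 : v < 1) (hb : 0 < b) :
    Tendsto (fun ε : ℝ =>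
        (∫ x in Set.Ioo (0:ℝ) (b - ε), x ^ (v - 1) / (x - b)) +
        (∫ x in Set.Ioi (b + ε), x ^ (v - 1) / (x - b)))
      (nhdsWithin 0 (Set.Ioi 0))
      (nhds (-π * b ^ (v - 1) * (Real.cos (π * v) / Real.sin (π * v)))) := by
  have hd : Tendsto (fun ε : ℝ => ε / b) (nhdsWithin 0 (Set.Ioi 0)) (nhdsWithin 0 (Set.Ioi 0)) := by
    refine tendsto_nhdsWithin_iff.mpr ⟨?_, ?_⟩
    · have : Tendsto (fun ε : ℝ => ε / b) (nhds 0) (nhds (0 / b)) :=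
        (continuous_id.div_const b).tendsto 0
      rw [zero_div] at this
      exact this.mono_left nhdsWithin_le_nhds
    · filter_upwards [self_mem_nhdsWithin] with ε hε
      exact div_pos hε hb
  have h := ((aux_main v hv0 hv1).comp hd).const_mul (b ^ (v-1))
  rw [show b ^ (v-1) * (-π * (Real.cos (π * v) / Real.sin (π * v))) =
    -π * b ^ (v - 1) * (Real.cos (π * v) / Real.sin (π * v)) by ring] at h
  refine h.congr' ?_
  filter_upwards [self_mem_nhdsWithin] with ε hε
  rw [aux_first v b ε hb, aux_second v b ε hb hε, ← mul_add]
  rfl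
end
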